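/- A Riemannian warped product space I ×_f 𝕄ⁿ admits a totally umbilical hypersurface Σ which is neither vertical nor horizontal at some point (t,p) ∈ I ×_f 𝕄ⁿ if and only if 𝕄ⁿ has, in a neighborhood of p, the structure of a warped product of an interval of the Euclidean line with some (n−1)-dimensional Riemannian manifold. -/

import Mathlib

noncomputable section
open Real Set

/-- Points of the coordinate chart `ℝⁿ`. -/
abbrev Pt (n : ℕ) := Fin n → ℝ

/-- The `i`-th standard coordinate vector. -/
def stdb (n : ℕ) (i : Fin n) : Pt n := Pi.single i 1

/-- Riemannian metric data in coordinates: a field of symmetric bilinear forms. -/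
abbrev Met (n : ℕ) := Pt n → Fin n → Fin n → ℝ

/-- The inner product of the vectors `v`, `w` at the point `x`, with respect to `g`. -/
def minner {n : ℕ} (g : Met n) (x v w : Pt n) : ℝ := ∑ i, ∑ j, g x i j * v i * w j

/-- `g` is a smooth Riemannian metric on `U`. -/
def IsMetricOn {n : ℕ} (U : Set (Pt n)) (g : Met n) : Prop :=
  (∀ i j, ContDiffOn ℝ (⊤ : ℕ∞) (fun x => g x i j) U) ∧
  (∀ x i j, g x i j = g x j i) ∧
  (∀ x ∈ U, ∀ v : Pt n, v ≠ 0 → 0 < minner g x v v)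

/-- The inverse metric `g^{kl}`. -/
def ginv {n : ℕ} (g : Met n) (x : Pt n) : Fin n → Fin n → ℝ :=
  fun k l => (Matrix.of (g x))⁻¹ k l

/-- The Christoffel symbols `Γᵏᵢⱼ` of the Levi-Civita connection of `g`. -/
def christoffel {n : ℕ} (g : Met n) (x : Pt n) (k i j : Fin n) : ℝ :=
  (1/2) * ∑ l, ginv g x k l *
    (fderiv ℝ (fun y => g y j l) x (stdb n i) + fderiv ℝ (fun y => g y i l) x (stdb n j)
      - fderiv ℝ (fun y => g y i j) x (stdb n l))

/-- The covariant derivative (Levi-Civita connection of `g`) of the vector field `Y`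
at the point `x` in the direction `v`. -/
def covD {n : ℕ} (g : Met n) (Y : Pt n → Pt n) (x v : Pt n) : Pt n :=
  fun k => fderiv ℝ (fun y => Y y k) x v + ∑ i, ∑ j, christoffel g x k i j * v i * Y x j

/-- `X` is a Killing field of `g` on `U`. -/
def IsKillingOn {n : ℕ} (U : Set (Pt n)) (g : Met n) (X : Pt n → Pt n) : Prop :=
  ∀ x ∈ U, ∀ v w : Pt n,
    minner g x (covD g X x v) w + minner g x (covD g X x w) v = 0

/-- `X` has unit length on `U`. -/
def IsUnitOn {n : ℕ} (U : Set (Pt n)) (g : Met n) (X : Pt n → Pt n) : Prop :=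
  ∀ x ∈ U, minner g x (X x) (X x) = 1

/-- The Lie bracket `[X,Y]` of two vector fields, in coordinates. -/
def lieB {n : ℕ} (X Y : Pt n → Pt n) (x : Pt n) : Pt n :=
  fun k => fderiv ℝ (fun y => Y y k) x (X x) - fderiv ℝ (fun y => X y k) x (Y x)

/-- A parametrized hypersurface `F : V → ℝ^{n+1}` with a chosen unit normal field `N`. -/
structure Hyp (n : ℕ) where
  V : Set (Pt n)
  F : Pt n → Pt (n+1)
  N : Pt n → Pt (n+1)

/-- The ambient covariant derivative, along the map `F`, of the ambient-vector-valued
field `W` defined on the parameter domain, in the coordinate direction `v`. -/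
def covAlong {n : ℕ} (g : Met (n+1)) (F W : Pt n → Pt (n+1)) (u v : Pt n) : Pt (n+1) :=
  fun k => fderiv ℝ (fun y => W y k) u v +
    ∑ i, ∑ j, christoffel g (F u) k i j * fderiv ℝ F u v i * W u j

/-- `S` is a smooth immersed hypersurface inside the chart `U`, with unit normal `N`. -/
def Hyp.IsRegular {n : ℕ} (S : Hyp n) (U : Set (Pt (n+1))) (g : Met (n+1)) : Prop :=
  IsOpen S.V ∧ ContDiffOn ℝ (⊤ : ℕ∞) S.F S.V ∧ (∀ u ∈ S.V, S.F u ∈ U) ∧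
  (∀ u ∈ S.V, LinearIndependent ℝ (fun a : Fin n => fderiv ℝ S.F u (stdb n a))) ∧
  ContDiffOn ℝ (⊤ : ℕ∞) S.N S.V ∧
  (∀ u ∈ S.V, minner g (S.F u) (S.N u) (S.N u) = 1) ∧
  (∀ u ∈ S.V, ∀ a : Fin n, minner g (S.F u) (S.N u) (fderiv ℝ S.F u (stdb n a)) = 0)

/-- `S` is totally geodesic: the shape operator `X ↦ -∇̃_X N` vanishes. -/
def Hyp.TotallyGeodesic {n : ℕ} (S : Hyp n) (g : Met (n+1)) : Prop :=
  ∀ u ∈ S.V, ∀ a : Fin n, covAlong g S.F S.N u (stdb n a) = 0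

/-- `S` is totally umbilical: the shape operator `X ↦ -∇̃_X N` is pointwise a
multiple of the identity. -/
def Hyp.TotallyUmbilical {n : ℕ} (S : Hyp n) (g : Met (n+1)) : Prop :=
  ∃ lam : Pt n → ℝ, ∀ u ∈ S.V, ∀ a : Fin n,
    covAlong g S.F S.N u (stdb n a) = lam u • fderiv ℝ S.F u (stdb n a)

/-- Projection onto the first `n` coordinates. -/
def projBase {n : ℕ} (x : Pt (n+1)) : Pt n := fun i => x i.castSucc

/-- The product metric of `g₀` with the Euclidean line (last coordinate). -/
def prodMet {n : ℕ} (g₀ : Met n) : Met (n+1) := fun x i j =>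
  Fin.lastCases (Fin.lastCases 1 (fun _ => 0) j)
    (fun i' => Fin.lastCases 0 (fun j' => g₀ (projBase x) i' j') j) i

/-- The coordinate domain of a product `𝕄 × I`. -/
def prodDom {n : ℕ} (U₀ : Set (Pt n)) (I : Set ℝ) : Set (Pt (n+1)) :=
  {x | projBase x ∈ U₀ ∧ x (Fin.last n) ∈ I}

/-- The unit vertical field `ξ` of a product `𝕄 × I`. -/
def vert (n : ℕ) : Pt (n+1) → Pt (n+1) := fun _ => stdb (n+1) (Fin.last n)

/-- The pullback of the metric `g` under the map `Φ`. -/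
def pullMet {n : ℕ} (g : Met n) (Φ : Pt n → Pt n) : Met n :=
  fun x i j => minner g (Φ x) (fderiv ℝ Φ x (stdb n i)) (fderiv ℝ Φ x (stdb n j))

/-- `g` has, on the coordinate domain `W`, the shape `dt² + f(t)² g_M` of a warped
product of an interval (the `0`-th coordinate) with an `n`-dimensional manifold. -/
def IsWarpedForm {n : ℕ} (g : Met (n+1)) (W : Set (Pt (n+1))) : Prop :=
  ∃ f : ℝ → ℝ, ContDiff ℝ (⊤ : ℕ∞) f ∧ (∀ t, 0 < f t) ∧
    ∀ x ∈ W, g x 0 0 = 1 ∧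
      (∀ i : Fin (n+1), i ≠ 0 → g x 0 i = 0 ∧ g x i 0 = 0) ∧
      (∀ i j : Fin (n+1), i ≠ 0 → j ≠ 0 →
        fderiv ℝ (fun y => g y i j / f (y 0) ^ 2) x (stdb (n+1) 0) = 0)

/-- The Riemannian manifold `(U₀, g₀)` has, in a neighborhood of `p`, the structure of a
warped product of an interval of the Euclidean line with an `n`-dimensional manifold:
there is a diffeomorphism `Φ` from a coordinate domain `W` onto a neighborhood of `p`
pulling `g₀` back to a warped-product metric. -/
def LocallyWarpedAt {n : ℕ} (U₀ : Set (Pt (n+1))) (g₀ : Met (n+1)) (p : Pt (n+1)) : Prop :=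
  ∃ (W : Set (Pt (n+1))) (Φ Ψ : Pt (n+1) → Pt (n+1)),
    IsOpen W ∧ ContDiffOn ℝ (⊤ : ℕ∞) Φ W ∧ MapsTo Φ W U₀ ∧
    IsOpen (Φ '' W) ∧ p ∈ Φ '' W ∧
    ContDiffOn ℝ (⊤ : ℕ∞) Ψ (Φ '' W) ∧ (∀ w ∈ W, Ψ (Φ w) = w) ∧
    IsWarpedForm (pullMet g₀ Φ) W

/-- The Levi-Civita symbol on three indices. -/
def lcSymb (i j k : Fin 3) : ℝ :=
  ((j.val : ℝ) - (i.val : ℝ)) * ((k.val : ℝ) - (i.val : ℝ)) * ((k.val : ℝ) - (j.val : ℝ)) / 2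

/-- The cross product of `v` and `w` at `x`, with respect to the metric `g` and the
orientation of the chart. -/
def crossG (g : Met 3) (x v w : Pt 3) : Pt 3 :=
  fun k => Real.sqrt (Matrix.det (Matrix.of (g x))) *
    ∑ l, ginv g x k l * ∑ i, ∑ j, lcSymb l i j * v i * w j

/-- The components `Rˡᵢⱼₖ` of the Riemann curvature tensor
(`R(∂ᵢ,∂ⱼ)∂ₖ = Rˡᵢⱼₖ ∂ₗ`, with `R(X,Y) = ∇_X∇_Y - ∇_Y∇_X - ∇_{[X,Y]}`). -/
def riem {n : ℕ} (g : Met n) (x : Pt n) (l i j k : Fin n) : ℝ :=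
  fderiv ℝ (fun y => christoffel g y l j k) x (stdb n i)
  - fderiv ℝ (fun y => christoffel g y l i k) x (stdb n j)
  + ∑ m, (christoffel g x l i m * christoffel g x m j k
      - christoffel g x l j m * christoffel g x m i k)

/-- The curvature operator `R(v,w)z` at `x`. -/
def riemVec {n : ℕ} (g : Met n) (x v w z : Pt n) : Pt n :=
  fun l => ∑ i, ∑ j, ∑ k, riem g x l i j k * v i * w j * z k

/-- `g` has constant sectional curvature `c` on `W`. -/
def HasConstCurv {n : ℕ} (W : Set (Pt n)) (g : Met n) (c : ℝ) : Prop :=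
  ∀ x ∈ W, ∀ v w : Pt n,
    minner g x (riemVec g x v w w) v
      = c * (minner g x v v * minner g x w w - (minner g x v w) ^ 2)

/-- The Ricci tensor of `g`. -/
def ricci {n : ℕ} (g : Met n) (x : Pt n) (j k : Fin n) : ℝ := ∑ i, riem g x i i j k

/-- The scalar curvature of `g`. -/
def scal {n : ℕ} (g : Met n) (x : Pt n) : ℝ := ∑ j, ∑ k, ginv g x j k * ricci g x j k

/-- The metric `dx² + sin²θ(x) dy² + cos²θ(x) dz²` on a three-dimensional chart. -/
def tgMet (θ : ℝ → ℝ) : Met 3 := fun x i j =>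
  if i = j then
    (if i = 0 then 1 else if i = 1 then (Real.sin (θ (x 0))) ^ 2 else (Real.cos (θ (x 0))) ^ 2)
  else 0

/-- The warped product metric `dt² + f(t)² g₀` (interval coordinate first). -/
def warpMet {n : ℕ} (f : ℝ → ℝ) (g₀ : Met n) : Met (n+1) := fun x i j =>
  Fin.cases (Fin.cases 1 (fun _ => 0) j)
    (fun i' => Fin.cases 0 (fun j' => f (x 0) ^ 2 * g₀ (Fin.tail x) i' j') j) i

/-- The coordinate domain of a warped product `I ×_f 𝕄` (interval coordinate first). -/
def warpDom {n : ℕ} (I : Set ℝ) (U₀ : Set (Pt n)) : Set (Pt (n+1)) :=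
  {x | x 0 ∈ I ∧ Fin.tail x ∈ U₀}

/-- The covariant acceleration of a curve `γ`, whose vanishing defines geodesics. -/
def curveAccel {n : ℕ} (g : Met n) (γ : ℝ → Pt n) (s : ℝ) : Pt n :=
  fun k => deriv (fun t => deriv (fun r => γ r k) t) s +
    ∑ i, ∑ j, christoffel g (γ s) k i j * deriv (fun r => γ r i) s * deriv (fun r => γ r j) s

/-- The velocity of a curve. -/
def vel {n : ℕ} (γ : ℝ → Pt n) (s : ℝ) : Pt n := fun k => deriv (fun r => γ r k) s

open Filter Topology Metric

/-- The inverse function theorem for smooth maps on an open set, with a smooth inverse. -/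
theorem exists_smooth_local_inverse {E F : Type*} [NormedAddCommGroup E] [NormedSpace ℝ E]
    [CompleteSpace E] [NormedAddCommGroup F] [NormedSpace ℝ F]
    {O : Set E} (hO : IsOpen O) {f : E → F} (hf : ContDiffOn ℝ (⊤ : ℕ∞) f O) {a : E} (ha : a ∈ O)
    (f' : E ≃L[ℝ] F) (hf' : HasFDerivAt f (f' : E →L[ℝ] F) a) :
    ∃ e : OpenPartialHomeomorph E F, a ∈ e.source ∧ e.source ⊆ O ∧ (∀ x, e x = f x) ∧
      ContDiffOn ℝ (⊤ : ℕ∞) e.symm e.target := by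
  have hfa : ContDiffAt ℝ (⊤ : ℕ∞) f a := hf.contDiffAt (hO.mem_nhds ha)
  let e₀ := hfa.toOpenPartialHomeomorph f hf' (by simp)
  have hcont : ContinuousOn (fderiv ℝ f) O := hf.continuousOn_fderiv_of_isOpen hO (by simp)
  let R : Set (E →L[ℝ] F) := range ((↑) : (E ≃L[ℝ] F) → E →L[ℝ] F)
  have hR : IsOpen R := ContinuousLinearEquiv.isOpen
  have hO' : IsOpen (O ∩ fderiv ℝ f ⁻¹' R) := hcont.isOpen_inter_preimage hO hR
  refine ⟨e₀.restr (O ∩ fderiv ℝ f ⁻¹' R), ?_, ?_, fun x => rfl, ?_⟩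
  · rw [OpenPartialHomeomorph.restr_source' _ _ hO']
    exact ⟨hfa.mem_toOpenPartialHomeomorph_source hf' (by simp), ha, f', hf'.fderiv.symm⟩
  · rw [OpenPartialHomeomorph.restr_source' _ _ hO']
    exact fun x hx => hx.2.1
  · intro y hy
    set e := e₀.restr (O ∩ fderiv ℝ f ⁻¹' R)
    have hx : e.symm y ∈ e.source := e.map_target hy
    rw [OpenPartialHomeomorph.restr_source' _ _ hO'] at hx
    obtain ⟨-, hxO, A, hA⟩ := hx
    have hc : ContDiffAt ℝ (⊤ : ℕ∞) f (e.symm y) := hf.contDiffAt (hO.mem_nhds hxO)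
    refine (e.contDiffAt_symm (f₀' := A) hy ?_ hc).contDiffWithinAt
    rw [hA]
    exact (hc.differentiableAt (by simp)).hasFDerivAt

section Nemytskii
universe u
variable {K : Type*} [TopologicalSpace K] [CompactSpace K]

/-- Pointwise application of a continuous family of linear maps to a continuous map. -/
noncomputable def ContinuousMap.clmApplyL (K : Type*) [TopologicalSpace K] [CompactSpace K]
    (E F : Type*)
    [NormedAddCommGroup E] [NormedSpace ℝ E] [NormedAddCommGroup F] [NormedSpace ℝ F] :
    C(K, E →L[ℝ] F) →L[ℝ] C(K, E) →L[ℝ] C(K, F) :=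
  LinearMap.mkContinuous₂
    (LinearMap.mk₂ ℝ (fun (A : C(K, E →L[ℝ] F)) (h : C(K, E)) =>
        (⟨fun x => A x (h x), by fun_prop⟩ : C(K, F)))
      (fun _ _ _ => by ext; simp) (fun _ _ _ => by ext; simp)
      (fun _ _ _ => by ext; simp) (fun _ _ _ => by ext; simp)) 1
    (fun A h => by
      rw [one_mul]
      refine (ContinuousMap.norm_le _ (by positivity)).2 fun x => ?_
      exact ((A x).le_opNorm _).trans
        (mul_le_mul (A.norm_coe_le_norm x) (h.norm_coe_le_norm x) (norm_nonneg _)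
          (by exact norm_nonneg A)))

theorem ContinuousMap.clmApplyL_apply {E F : Type*}
    [NormedAddCommGroup E] [NormedSpace ℝ E] [NormedAddCommGroup F] [NormedSpace ℝ F]
    (A : C(K, E →L[ℝ] F)) (h : C(K, E)) (x : K) :
    ContinuousMap.clmApplyL K E F A h x = A x (h x) := rfl

theorem exists_forall_norm_comp_sub_le {E G : Type*} [NormedAddCommGroup E]
    [NormedAddCommGroup G] (f : C(E, G)) (γ : C(K, E)) {c : ℝ} (hc : 0 < c) :
    ∃ δ > 0, ∀ γ' : C(K, E), dist γ' γ < δ → ∀ x, ‖f (γ' x) - f (γ x)‖ ≤ c := by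
  have hcont : Continuous fun γ : C(K, E) => f.comp γ := ContinuousMap.continuous_postcomp f
  obtain ⟨δ, hδ, hball⟩ := Metric.continuous_iff.1 hcont γ c hc
  refine ⟨δ, hδ, fun γ' hγ' x => ?_⟩
  have h := (ContinuousMap.dist_apply_le_dist x).trans (hball γ' hγ').le
  rwa [dist_eq_norm] at h

theorem hasFDerivAt_comp_left {E F : Type*}
    [NormedAddCommGroup E] [NormedSpace ℝ E] [NormedAddCommGroup F] [NormedSpace ℝ F]
    (f : C(E, F)) (hf : Differentiable ℝ f) (f' : C(E, E →L[ℝ] F))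
    (hf' : ∀ x, fderiv ℝ f x = f' x) (γ : C(K, E)) :
    HasFDerivAt (fun γ : C(K, E) => f.comp γ)
      (ContinuousMap.clmApplyL K E F (f'.comp γ)) γ := by
  rw [hasFDerivAt_iff_isLittleO_nhds_zero, Asymptotics.isLittleO_iff]
  intro c hc
  obtain ⟨δ, hδ, hball⟩ := exists_forall_norm_comp_sub_le f' γ hc
  filter_upwards [Metric.ball_mem_nhds (0 : C(K, E)) hδ] with h hh
  rw [mem_ball_zero_iff] at hh
  refine (ContinuousMap.norm_le _ (by positivity)).2 fun x => ?_
  have hbound : ∀ y ∈ Metric.ball (γ x) δ, ‖f' y - f' (γ x)‖ ≤ c := by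
    intro y hy
    have h1 := hball (γ + ContinuousMap.const K (y - γ x)) (by
      rw [dist_eq_norm, add_sub_cancel_left]
      refine lt_of_le_of_lt ((ContinuousMap.norm_le _ (norm_nonneg (y - γ x))).2
        fun z => le_rfl) ?_
      rwa [← dist_eq_norm]) x
    simpa using h1
  have hmv := (convex_ball (γ x) δ).norm_image_sub_le_of_norm_hasFDerivWithin_le'
    (f := f) (f' := fun y => f' y) (φ := f' (γ x)) (C := c) (x := γ x) (y := γ x + h x)
    (fun y _ => by
      have := (hf y).hasFDerivAt
      rw [hf'] at this
      exact this.hasFDerivWithinAt) hbound (mem_ball_self hδ)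
    (by
      rw [mem_ball, dist_eq_norm, add_sub_cancel_left]
      exact lt_of_le_of_lt (h.norm_coe_le_norm x) hh)
  rw [add_sub_cancel_left] at hmv
  refine le_trans (le_of_eq ?_) (hmv.trans
    (mul_le_mul_of_nonneg_left (h.norm_coe_le_norm x) hc.le))
  simp [ContinuousMap.clmApplyL_apply]

theorem contDiff_comp_left_nat (n : ℕ) {E F : Type u}
    [NormedAddCommGroup E] [NormedSpace ℝ E] [NormedAddCommGroup F] [NormedSpace ℝ F]
    (f : C(E, F)) (hf : ContDiff ℝ (⊤ : ℕ∞) f) :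
    ContDiff ℝ n (fun γ : C(K, E) => f.comp γ) := by
  induction n generalizing F with
  | zero => exact contDiff_zero.2 (ContinuousMap.continuous_postcomp f)
  | succ n ih =>
    have hf1 : ContDiff ℝ (⊤ : ℕ∞) (fderiv ℝ f) := hf.fderiv_right (by simp)
    let f' : C(E, E →L[ℝ] F) := ⟨fderiv ℝ f, hf1.continuous⟩
    have key := hasFDerivAt_comp_left (K := K) f (hf.differentiable (by simp)) f' (fun x => rfl)
    refine (contDiff_succ_iff_hasFDerivAt (n := n)).2 ⟨_, ?_, key⟩
    exact (ContinuousMap.clmApplyL K E F).contDiff.comp (ih f' hf1)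

theorem contDiff_comp_left {E F : Type u}
    [NormedAddCommGroup E] [NormedSpace ℝ E] [NormedAddCommGroup F] [NormedSpace ℝ F]
    (f : C(E, F)) (hf : ContDiff ℝ (⊤ : ℕ∞) f) :
    ContDiff ℝ (⊤ : ℕ∞) (fun γ : C(K, E) => f.comp γ) :=
  contDiff_infty.2 fun n => contDiff_comp_left_nat n f hf

end Nemytskii

section Flow
universe u
variable {E : Type u} [NormedAddCommGroup E] [NormedSpace ℝ E]

/-- The primitive vanishing at `0` of a continuous curve defined on `[-1, 1]`. -/
noncomputable def primitiveL (E : Type u) [NormedAddCommGroup E] [NormedSpace ℝ E] :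
    C(Icc (-1 : ℝ) 1, E) →L[ℝ] C(Icc (-1 : ℝ) 1, E) :=
  LinearMap.mkContinuous
    { toFun := fun γ => ⟨fun s => ∫ r in (0 : ℝ)..s, γ (projIcc (-1) 1 (by norm_num) r), by
        have h : Continuous fun r : ℝ => γ (projIcc (-1) 1 (by norm_num) r) :=
          γ.continuous.comp continuous_projIcc
        exact (intervalIntegral.continuous_primitive
          (fun a b => h.intervalIntegrable a b) 0).comp continuous_subtype_val⟩
      map_add' := fun γ η => by
        ext s
        have h (γ : C(Icc (-1 : ℝ) 1, E)) :
            Continuous fun r : ℝ => γ (projIcc (-1) 1 (by norm_num) r) :=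
          γ.continuous.comp continuous_projIcc
        exact intervalIntegral.integral_add ((h γ).intervalIntegrable _ _)
          ((h η).intervalIntegrable _ _)
      map_smul' := fun c γ => by
        ext s
        exact intervalIntegral.integral_smul c _ } 1
    (fun γ => by
      rw [one_mul]
      refine (ContinuousMap.norm_le _ (norm_nonneg _)).2 fun s => ?_
      refine (intervalIntegral.norm_integral_le_of_norm_le_const
        (fun r _ => γ.norm_coe_le_norm _)).trans ?_
      have : |(s : ℝ) - 0| ≤ 1 := by
        rw [sub_zero, abs_le]; exact s.2
      exact mul_le_of_le_one_right (norm_nonneg _) this)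

/-- The embedding of a space into the continuous curves as the constant curves. -/
noncomputable def constL (E : Type u) [NormedAddCommGroup E] [NormedSpace ℝ E] :
    E →L[ℝ] C(Icc (-1 : ℝ) 1, E) :=
  LinearMap.mkContinuous
    { toFun := fun x => ContinuousMap.const _ x
      map_add' := fun _ _ => rfl
      map_smul' := fun _ _ => rfl } 1
    (fun x => by
      rw [one_mul]
      exact (ContinuousMap.norm_le _ (norm_nonneg _)).2 fun s => le_rfl)

theorem constL_apply (x : E) (s : Icc (-1 : ℝ) 1) : constL E x s = x := rfl

/-- The integral equation `γ = x + t ∫ X ∘ γ` is uniquely and smoothly solvable near `t = 0`. -/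
theorem exists_smooth_solution [CompleteSpace E] (X : E → E) (hX : ContDiff ℝ (⊤ : ℕ∞) X) (p : E) :
    ∃ ε₁ > 0, ∃ T : Set (ℝ × E), IsOpen T ∧ ((0 : ℝ), p) ∈ T ∧
      ∃ Γ : ℝ × E → C(Icc (-1 : ℝ) 1, E), ContDiffOn ℝ (⊤ : ℕ∞) Γ T ∧
        Γ (0, p) = constL E p ∧
        (∀ q ∈ T, Γ q = constL E q.2 +
          q.1 • primitiveL E ((⟨X, hX.continuous⟩ : C(E, E)).comp (Γ q))) ∧
        (∀ q ∈ T, |q.1| < ε₁ → dist q.2 p < ε₁ → ∀ γ, dist γ (constL E p) < ε₁ →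
          γ = constL E q.2 + q.1 • primitiveL E ((⟨X, hX.continuous⟩ : C(E, E)).comp γ) →
          Γ q = γ) := by
  set Xc : C(E, E) := ⟨X, hX.continuous⟩ with hXc
  let 𝒞 := C(Icc (-1 : ℝ) 1, E)
  let G : 𝒞 → 𝒞 := fun γ => primitiveL E (Xc.comp γ)
  have hG : ContDiff ℝ (⊤ : ℕ∞) G :=
    (primitiveL E).contDiff.comp (contDiff_comp_left Xc hX)
  let H : ℝ × E × 𝒞 → ℝ × E × 𝒞 := fun z =>
    (z.1, z.2.1, z.2.2 - constL E z.2.1 - z.1 • G z.2.2)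
  have hH : ContDiff ℝ (⊤ : ℕ∞) H := by
    refine contDiff_fst.prodMk ((contDiff_fst.comp contDiff_snd).prodMk ?_)
    refine ((contDiff_snd.comp contDiff_snd).sub
      ((constL E).contDiff.comp (contDiff_fst.comp contDiff_snd))).sub ?_
    exact contDiff_fst.smul (hG.comp (contDiff_snd.comp contDiff_snd))
  set a : ℝ × E × 𝒞 := (0, p, constL E p) with ha
  let N : (ℝ × E × 𝒞) →L[ℝ] (ℝ × E × 𝒞) :=
    (0 : (ℝ × E × 𝒞) →L[ℝ] ℝ).prod ((0 : (ℝ × E × 𝒞) →L[ℝ] E).prod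
      ((constL E).comp ((ContinuousLinearMap.fst ℝ E 𝒞).comp (ContinuousLinearMap.snd ℝ ℝ (E × 𝒞)))
        + (ContinuousLinearMap.fst ℝ ℝ (E × 𝒞)).smulRight (G (constL E p))))
  have hN : ∀ z, N z = (0, 0, constL E z.2.1 + z.1 • G (constL E p)) := fun z => rfl
  let A : (ℝ × E × 𝒞) ≃L[ℝ] (ℝ × E × 𝒞) :=
    ContinuousLinearEquiv.equivOfInverse (ContinuousLinearMap.id ℝ _ - N)
      (ContinuousLinearMap.id ℝ _ + N)
      (fun z => by simp [hN]) (fun z => by simp [hN])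
  have hA : HasFDerivAt H (A : (ℝ × E × 𝒞) →L[ℝ] (ℝ × E × 𝒞)) a := by
    have h1 : HasFDerivAt (fun z : ℝ × E × 𝒞 => z.1) (ContinuousLinearMap.fst ℝ ℝ (E × 𝒞)) a :=
      hasFDerivAt_fst
    have h2 : HasFDerivAt (fun z : ℝ × E × 𝒞 => z.2.1)
      ((ContinuousLinearMap.fst ℝ E 𝒞).comp (ContinuousLinearMap.snd ℝ ℝ (E × 𝒞))) a :=
      ((ContinuousLinearMap.fst ℝ E 𝒞).comp (ContinuousLinearMap.snd ℝ ℝ (E × 𝒞))).hasFDerivAt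
    have h3 : HasFDerivAt (fun z : ℝ × E × 𝒞 => z.2.2)
      ((ContinuousLinearMap.snd ℝ E 𝒞).comp (ContinuousLinearMap.snd ℝ ℝ (E × 𝒞))) a :=
      ((ContinuousLinearMap.snd ℝ E 𝒞).comp (ContinuousLinearMap.snd ℝ ℝ (E × 𝒞))).hasFDerivAt
    have hGa : HasFDerivAt G (fderiv ℝ G a.2.2) a.2.2 :=
      (hG.differentiable (by simp) _).hasFDerivAt
    have h4 := h1.smul (hGa.comp a h3)
    have h5 := (h3.sub ((constL E).hasFDerivAt.comp a h2)).sub h4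
    refine (h1.prodMk (h2.prodMk h5)).congr_fderiv ?_
    refine ContinuousLinearMap.ext fun z => Prod.ext ?_ (Prod.ext ?_ ?_)
    · simp [A, hN, a]
    · simp [A, hN, a]
    · simp [A, hN, a, sub_sub]
  obtain ⟨e, hae, -, heH, hesymm⟩ :=
    exists_smooth_local_inverse isOpen_univ hH.contDiffOn (mem_univ a) A hA
  obtain ⟨ε₁, hε₁, hball⟩ := Metric.isOpen_iff.1 e.open_source a hae
  let ι : ℝ × E → ℝ × E × 𝒞 := fun q => (q.1, q.2, 0)
  have hι : ContDiff ℝ (⊤ : ℕ∞) ι :=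
    contDiff_fst.prodMk (contDiff_snd.prodMk contDiff_const)
  have hHa : e a = ι (0, p) := by simp [heH, H, a, ι]
  refine ⟨ε₁, hε₁, ι ⁻¹' e.target, e.open_target.preimage hι.continuous, ?_,
    fun q => (e.symm (ι q)).2.2, ?_, ?_, ?_, ?_⟩
  · rw [mem_preimage, ← hHa]; exact e.map_source hae
  · exact (contDiff_snd.comp contDiff_snd).comp_contDiffOn
      (hesymm.comp hι.contDiffOn (fun q hq => hq))
  · simp only [← hHa, e.left_inv hae, a]
  · intro q hq
    have h := e.right_inv hq
    rw [heH] at h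
    have h1 : (e.symm (ι q)).1 = q.1 := congrArg (fun z => z.1) h
    have h2 : (e.symm (ι q)).2.1 = q.2 := congrArg (fun z => z.2.1) h
    have h3 : (e.symm (ι q)).2.2 - constL E (e.symm (ι q)).2.1
      - (e.symm (ι q)).1 • G (e.symm (ι q)).2.2 = 0 := congrArg (fun z => z.2.2) h
    rw [h1, h2, sub_sub, sub_eq_zero] at h3
    exact h3
  · intro q hq hq1 hq2 γ hγ hγe
    have hs : (q.1, q.2, γ) ∈ e.source := by
      apply hball
      simp only [ha, mem_ball, Prod.dist_eq, max_lt_iff, Real.dist_eq, sub_zero]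
      exact ⟨hq1, hq2, hγ⟩
    have h : e (q.1, q.2, γ) = ι q := by
      simp only [heH, H, ι, Prod.mk.injEq, true_and]
      rw [sub_sub, sub_eq_zero]
      exact hγe
    simp only [← h, e.left_inv hs]


/-- The reparametrization `s ↦ γ (k s)` of a curve on `[-1, 1]`. -/
noncomputable def rescaleCurve (k : ℝ) (γ : C(Icc (-1 : ℝ) 1, E)) : C(Icc (-1 : ℝ) 1, E) :=
  ⟨fun s => γ (projIcc (-1) 1 (by norm_num) (k * s)),
    by
    have h : Continuous fun s : Icc (-1 : ℝ) 1 => k * (s : ℝ) := by fun_prop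
    exact γ.continuous.comp ((continuous_projIcc (h := by norm_num)).comp h)⟩

theorem rescaleCurve_solution (Xc : C(E, E)) {t : ℝ} {x : E} {γ : C(Icc (-1 : ℝ) 1, E)}
    (hγ : γ = constL E x + t • primitiveL E (Xc.comp γ)) {k : ℝ} (hk : |k| ≤ 1) :
    rescaleCurve k γ = constL E x + (k * t) • primitiveL E (Xc.comp (rescaleCurve k γ)) := by
  have hkmem : ∀ s ∈ Icc (-1 : ℝ) 1, k * s ∈ Icc (-1 : ℝ) 1 := fun s hs =>
    abs_le.1 (by
      rw [abs_mul]
      exact mul_le_one₀ hk (abs_nonneg _) (abs_le.2 hs))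
  let g : ℝ → E := fun r => Xc (γ (projIcc (-1) 1 (by norm_num) r))
  ext s
  have h1 : rescaleCurve k γ s = x + t • ∫ r in (0 : ℝ)..(k * s), g r := by
    have h := congrArg (fun γ : C(Icc (-1 : ℝ) 1, E) => γ ⟨k * s, hkmem s s.2⟩) hγ
    change γ (projIcc (-1) 1 (by norm_num) (k * s)) = _
    rw [projIcc_of_mem _ (hkmem s s.2)]
    exact h
  have h2 : ∫ r in (0 : ℝ)..s, Xc (rescaleCurve k γ (projIcc (-1) 1 (by norm_num) r))
      = ∫ r in (0 : ℝ)..s, g (k * r) := by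
    refine intervalIntegral.integral_congr fun r hr => ?_
    have hr' : r ∈ Icc (-1 : ℝ) 1 := (ordConnected_Icc.uIcc_subset (by norm_num) s.2) hr
    simp only [projIcc_of_mem _ hr']
    rfl
  have h3 : (constL E x + (k * t) • primitiveL E (Xc.comp (rescaleCurve k γ))) s =
      x + (k * t) • ∫ r in (0 : ℝ)..s, g (k * r) := by
    rw [← h2]; rfl
  rw [h1, h3, mul_comm k t, mul_smul, intervalIntegral.smul_integral_comp_mul_left, mul_zero]

theorem hasDerivAt_of_solution [CompleteSpace E] (Xc : C(E, E)) {t : ℝ} {x : E}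
    {γ : C(Icc (-1 : ℝ) 1, E)}
    (hγ : γ = constL E x + t • primitiveL E (Xc.comp γ)) {s : ℝ} (hs : |s| < 1) :
    HasDerivAt (fun s => γ (projIcc (-1) 1 (by norm_num) s))
      (t • Xc (γ (projIcc (-1) 1 (by norm_num) s))) s := by
  let g : ℝ → E := fun r => Xc (γ (projIcc (-1) 1 (by norm_num) r))
  have hg : Continuous g := Xc.continuous.comp (γ.continuous.comp continuous_projIcc)
  have hev : (fun s => γ (projIcc (-1) 1 (by norm_num) s)) =ᶠ[𝓝 s]
      fun s => x + t • ∫ r in (0 : ℝ)..s, g r := by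
    have : ∀ᶠ s in 𝓝 s, |s| < 1 := (continuous_abs.tendsto s).eventually (gt_mem_nhds hs)
    filter_upwards [this] with r hr
    have hr' : r ∈ Icc (-1 : ℝ) 1 := abs_le.1 hr.le
    rw [projIcc_of_mem _ hr']
    exact congrArg (fun γ : C(Icc (-1 : ℝ) 1, E) => γ ⟨r, hr'⟩) hγ
  refine HasDerivAt.congr_of_eventuallyEq ?_ hev
  have h1 : HasDerivAt (fun u => ∫ r in (0 : ℝ)..u, g r) (g s) s :=
    intervalIntegral.integral_hasDerivAt_right (hg.intervalIntegrable _ _)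
      (hg.stronglyMeasurableAtFilter _ _) hg.continuousAt
  exact (h1.const_smul t).const_add x

/-- The local flow of a smooth vector field is jointly smooth. -/
theorem exists_smooth_flow_of_contDiff [CompleteSpace E] (X : E → E)
    (hX : ContDiff ℝ (⊤ : ℕ∞) X) (p : E) :
    ∃ ε > 0, ∃ fl : ℝ × E → E, ContDiffOn ℝ (⊤ : ℕ∞) fl (ball ((0 : ℝ), p) ε) ∧
      (∀ x ∈ ball p ε, fl (0, x) = x) ∧
      ∀ q ∈ ball ((0 : ℝ), p) ε, HasDerivAt (fun s => fl (s, q.2)) (X (fl q)) q.1 := by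
  obtain ⟨ε₁, hε₁, T, hT, hpT, Γ, hΓ, hΓp, hsol, huniq⟩ := exists_smooth_solution X hX p
  set Xc : C(E, E) := ⟨X, hX.continuous⟩ with hXc
  have hcont : ContinuousAt Γ (0, p) := (hΓ.continuousOn).continuousAt (hT.mem_nhds hpT)
  obtain ⟨ε₂, hε₂, hsub⟩ := Metric.mem_nhds_iff.1
    (inter_mem (hT.mem_nhds hpT) (hcont.preimage_mem_nhds (ball_mem_nhds _ hε₁)))
  obtain ⟨δ, hδ, hδ₁, hδ₂⟩ : ∃ δ > 0, δ < ε₁ ∧ δ < ε₂ :=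
    ⟨min ε₁ ε₂ / 2, by positivity,
      (half_lt_self (lt_min hε₁ hε₂)).trans_le (min_le_left _ _),
      (half_lt_self (lt_min hε₁ hε₂)).trans_le (min_le_right _ _)⟩
  have hmem : ∀ t x, |t| ≤ δ → x ∈ ball p δ →
      (t, x) ∈ T ∧ dist (Γ (t, x)) (constL E p) < ε₁ := by
    intro t x ht hx
    have h := hsub (show (t, x) ∈ ball ((0 : ℝ), p) ε₂ by
      simp only [mem_ball, Prod.dist_eq, max_lt_iff, Real.dist_eq, sub_zero]
      exact ⟨ht.trans_lt hδ₂, (mem_ball.1 hx).trans hδ₂⟩)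
    refine ⟨h.1, ?_⟩
    have h2 := h.2
    rwa [mem_preimage, hΓp] at h2
  let o : Icc (-1 : ℝ) 1 := ⟨1, by norm_num⟩
  have hscale : ∀ x ∈ ball p δ, ∀ t, |t| < δ →
      Γ (t, x) o = Γ (δ, x) (projIcc (-1) 1 (by norm_num) (t / δ)) := by
    intro x hx t ht
    have hk : |t / δ| ≤ 1 := by
      rw [abs_div, abs_of_pos hδ]; exact (div_le_one hδ).2 ht.le
    obtain ⟨hT1, hdist⟩ := hmem δ x (abs_of_pos hδ).le hx
    have hres := rescaleCurve_solution Xc (hsol _ hT1) hk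
    simp only [div_mul_cancel₀ _ hδ.ne'] at hres
    rw [huniq (t, x) (hmem t x ht.le hx).1 (ht.trans hδ₁) ((mem_ball.1 hx).trans hδ₁)
      (rescaleCurve (t / δ) (Γ (δ, x))) ?_ hres]
    · change Γ (δ, x) (projIcc (-1) 1 (by norm_num) (t / δ * 1)) = _
      rw [mul_one]
    · refine (ContinuousMap.dist_lt_iff hε₁).2 fun s => ?_
      exact (ContinuousMap.dist_apply_le_dist (f := Γ (δ, x)) (g := constL E p)
        (projIcc (-1) 1 (by norm_num) (t / δ * s))).trans_lt hdist
  refine ⟨δ, hδ, fun q => Γ q o, ?_, ?_, ?_⟩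
  · have hsubT : ball ((0 : ℝ), p) δ ⊆ T := fun q hq => by
      simp only [mem_ball, Prod.dist_eq, max_lt_iff, Real.dist_eq, sub_zero] at hq
      exact (hmem q.1 q.2 hq.1.le hq.2).1
    exact (ContinuousMap.evalCLM ℝ o).contDiff.comp_contDiffOn (hΓ.mono hsubT)
  · intro x hx
    have h := hsol (0, x) (hmem 0 x (by simpa using hδ.le) hx).1
    simp only [zero_smul, add_zero] at h
    change Γ (0, x) o = x
    rw [h, constL_apply]
  · rintro ⟨t, x⟩ hq
    simp only [mem_ball, Prod.dist_eq, max_lt_iff, Real.dist_eq, sub_zero] at hq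
    obtain ⟨ht, hx⟩ := hq
    have hev : (fun s => Γ (s, x) o) =ᶠ[𝓝 t]
        fun s => Γ (δ, x) (projIcc (-1) 1 (by norm_num) (s / δ)) := by
      have : ∀ᶠ s in 𝓝 t, |s| < δ := (continuous_abs.tendsto t).eventually (gt_mem_nhds ht)
      filter_upwards [this] with s hs using hscale x hx s hs
    refine HasDerivAt.congr_of_eventuallyEq ?_ hev
    have h1 := hasDerivAt_of_solution Xc (hsol _ (hmem δ x (abs_of_pos hδ).le hx).1)
      (s := t / δ) (by rw [abs_div, abs_of_pos hδ]; exact (div_lt_one hδ).2 ht)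
    have h2 : HasDerivAt (fun s : ℝ => s / δ) (1 / δ) t := (hasDerivAt_id t).div_const δ
    refine (h1.scomp t h2).congr_deriv ?_
    simp only [smul_smul, one_div_mul_cancel hδ.ne', one_smul, hscale x hx t ht]
    rfl

/-- The local flow of a vector field which is smooth near a point. -/
theorem exists_smooth_flow [FiniteDimensional ℝ E] {O : Set E} (hO : IsOpen O) {X : E → E}
    (hX : ContDiffOn ℝ (⊤ : ℕ∞) X O) {p : E} (hp : p ∈ O) :
    ∃ ε > 0, ∃ fl : ℝ × E → E, ContDiffOn ℝ (⊤ : ℕ∞) fl (ball ((0 : ℝ), p) ε) ∧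
      (∀ x ∈ ball p ε, fl (0, x) = x) ∧
      ∀ q ∈ ball ((0 : ℝ), p) ε, fl q ∈ O ∧
        HasDerivAt (fun s => fl (s, q.2)) (X (fl q)) q.1 := by
  have : CompleteSpace E := FiniteDimensional.complete ℝ E
  obtain ⟨r, hr, hrO⟩ := Metric.isOpen_iff.1 hO p hp
  let b : ContDiffBump p := ⟨r / 3, r / 2, by positivity, by linarith⟩
  have hbX : ContDiff ℝ (⊤ : ℕ∞) fun x => b x • X x := by
    refine contDiff_iff_contDiffAt.2 fun x => ?_
    by_cases hx : x ∈ closedBall p (r / 2)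
    · exact b.contDiffAt.smul (hX.contDiffAt (hO.mem_nhds (hrO
        (closedBall_subset_ball (half_lt_self hr) hx))))
    · have h : (fun x => b x • X x) =ᶠ[𝓝 x] fun _ => 0 := by
        filter_upwards [isClosed_closedBall.isOpen_compl.mem_nhds hx] with y hy
        rw [b.zero_of_le_dist (not_le.1 (fun h => hy (mem_closedBall.2 h))).le, zero_smul]
      exact contDiffAt_const.congr_of_eventuallyEq h
  obtain ⟨ε, hε, fl, hfl, hfl0, hflX⟩ := exists_smooth_flow_of_contDiff _ hbX p
  have hcont : ContinuousAt fl (0, p) :=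
    hfl.continuousOn.continuousAt (ball_mem_nhds _ hε)
  obtain ⟨η, hη, hsub⟩ := Metric.mem_nhds_iff.1
    (inter_mem (ball_mem_nhds ((0 : ℝ), p) hε)
      (hcont.preimage_mem_nhds (t := closedBall p (r / 3)) (by
        rw [hfl0 p (mem_ball_self hε)]
        exact closedBall_mem_nhds _ (by positivity))))
  refine ⟨min η ε, lt_min hη hε, fl, hfl.mono (ball_subset_ball (min_le_right _ _)),
    fun x hx => hfl0 x (ball_subset_ball (min_le_right _ _) hx), fun q hq => ?_⟩
  have hq' := (hsub (ball_subset_ball (min_le_left _ _) hq)).2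
  refine ⟨hrO (closedBall_subset_ball (by linarith) hq'), ?_⟩
  have h := hflX q (ball_subset_ball (min_le_right _ _) hq)
  rwa [b.one_of_mem_closedBall hq', one_smul] at h

end Flow

section MetricAlgebra
variable {n : ℕ}

theorem minner_add_left (g : Met n) (x v v' w : Pt n) :
    minner g x (v + v') w = minner g x v w + minner g x v' w := by
  simp only [minner, Pi.add_apply, ← Finset.sum_add_distrib]
  exact Finset.sum_congr rfl fun i _ => Finset.sum_congr rfl fun j _ => by ring

theorem minner_add_right (g : Met n) (x v w w' : Pt n) :
    minner g x v (w + w') = minner g x v w + minner g x v w' := by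
  simp only [minner, Pi.add_apply, ← Finset.sum_add_distrib]
  exact Finset.sum_congr rfl fun i _ => Finset.sum_congr rfl fun j _ => by ring

theorem minner_smul_left (g : Met n) (x v w : Pt n) (c : ℝ) :
    minner g x (c • v) w = c * minner g x v w := by
  simp only [minner, Pi.smul_apply, smul_eq_mul, Finset.mul_sum]
  exact Finset.sum_congr rfl fun i _ => Finset.sum_congr rfl fun j _ => by ring

theorem minner_smul_right (g : Met n) (x v w : Pt n) (c : ℝ) :
    minner g x v (c • w) = c * minner g x v w := by
  simp only [minner, Pi.smul_apply, smul_eq_mul, Finset.mul_sum]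
  exact Finset.sum_congr rfl fun i _ => Finset.sum_congr rfl fun j _ => by ring

theorem minner_zero_left (g : Met n) (x w : Pt n) : minner g x 0 w = 0 := by
  simp [minner]

theorem minner_zero_right (g : Met n) (x w : Pt n) : minner g x w 0 = 0 := by
  simp [minner]

theorem minner_neg_left (g : Met n) (x v w : Pt n) :
    minner g x (-v) w = -minner g x v w := by
  simpa using minner_smul_left g x v w (-1)

theorem minner_sub_left (g : Met n) (x v v' w : Pt n) :
    minner g x (v - v') w = minner g x v w - minner g x v' w := by
  rw [sub_eq_add_neg, minner_add_left, minner_neg_left, sub_eq_add_neg]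

/-- The regularity of metric data at a point which makes the Levi-Civita connection meaningful
there. -/
structure Met.RegularAt (g : Met n) (x : Pt n) : Prop where
  symm : ∀ y i j, g y i j = g y j i
  diff : ∀ i j, DifferentiableAt ℝ (fun y => g y i j) x
  pos : ∀ v : Pt n, v ≠ 0 → 0 < minner g x v v

theorem IsMetricOn.regularAt {U : Set (Pt n)} {g : Met n} (hg : IsMetricOn U g) (hU : IsOpen U)
    {x : Pt n} (hx : x ∈ U) : g.RegularAt x :=
  ⟨hg.2.1, fun i j => ((hg.1 i j).contDiffAt (hU.mem_nhds hx)).differentiableAt (by simp),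
    hg.2.2 x hx⟩

theorem minner_comm {g : Met n} (hg : ∀ y i j, g y i j = g y j i) (x v w : Pt n) :
    minner g x v w = minner g x w v := by
  rw [minner, Finset.sum_comm]
  exact Finset.sum_congr rfl fun i _ => Finset.sum_congr rfl fun j _ => by rw [hg x j i]; ring

theorem Met.RegularAt.eq_zero {g : Met n} {x : Pt n} (hg : g.RegularAt x) {v : Pt n}
    (h : minner g x v v = 0) : v = 0 := by
  by_contra hv
  exact (hg.pos v hv).ne' h

theorem Met.RegularAt.ext {g : Met n} {x : Pt n} (hg : g.RegularAt x) {v w : Pt n}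
    (h : ∀ z, minner g x v z = minner g x w z) : v = w := by
  refine sub_eq_zero.1 (hg.eq_zero ?_)
  rw [minner_sub_left, h, sub_self]

theorem Met.RegularAt.isUnit_det {g : Met n} {x : Pt n} (hg : g.RegularAt x) :
    IsUnit (Matrix.of (g x)).det := by
  rw [isUnit_iff_ne_zero]
  intro h0
  obtain ⟨v, hv, hv0⟩ := Matrix.exists_mulVec_eq_zero_iff.2 h0
  refine hv (hg.eq_zero ?_)
  have h : ∀ i, ∑ j, g x i j * v j = 0 := fun i => congrFun hv0 i
  calc minner g x v v = ∑ i, v i * ∑ j, g x i j * v j := by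
        simp only [minner, Finset.mul_sum]
        exact Finset.sum_congr rfl fun i _ => Finset.sum_congr rfl fun j _ => by ring
    _ = 0 := by simp [h]

/-- The derivative of the metric in the direction `ξ`, evaluated on `v` and `w`. -/
def dmet (g : Met n) (x ξ v w : Pt n) : ℝ :=
  ∑ i, ∑ j, fderiv ℝ (fun y => g y i j) x ξ * v i * w j

/-- The connection form of the Levi-Civita connection in coordinates. -/
def connForm (g : Met n) (x v w : Pt n) : Pt n :=
  fun k => ∑ i, ∑ j, christoffel g x k i j * v i * w j

theorem Met.RegularAt.sum_mul_christoffel {g : Met n} {x : Pt n} (hg : g.RegularAt x)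
    (m i j : Fin n) :
    ∑ k, g x m k * christoffel g x k i j = (1 / 2) *
      (fderiv ℝ (fun y => g y j m) x (stdb n i) + fderiv ℝ (fun y => g y i m) x (stdb n j)
        - fderiv ℝ (fun y => g y i j) x (stdb n m)) := by
  set B : Fin n → ℝ := fun l => fderiv ℝ (fun y => g y j l) x (stdb n i) +
    fderiv ℝ (fun y => g y i l) x (stdb n j) - fderiv ℝ (fun y => g y i j) x (stdb n l)
  have h : (Matrix.of (g x) * (Matrix.of (g x))⁻¹).mulVec B = B := by
    rw [Matrix.mul_nonsing_inv _ hg.isUnit_det, Matrix.one_mulVec]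
  rw [← Matrix.mulVec_mulVec] at h
  have h' : ∑ k, g x m k * ∑ l, ginv g x k l * B l = B m := congrFun h m
  change _ = 1 / 2 * B m
  rw [← h', Finset.mul_sum]
  exact Finset.sum_congr rfl fun k _ => by simp only [christoffel, B]; ring

theorem fderiv_eq_sum (φ : Pt n → ℝ) (x v : Pt n) :
    fderiv ℝ φ x v = ∑ i, v i * fderiv ℝ φ x (stdb n i) := by
  have h : v = ∑ i, v i • stdb n i := by
    ext j
    simp [stdb, Pi.single_apply]
  conv_lhs => rw [h]
  simp

theorem dmet_eq_sum (g : Met n) (x ξ v w : Pt n) :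
    dmet g x ξ v w =
      ∑ k, ∑ i, ∑ j, fderiv ℝ (fun y => g y i j) x (stdb n k) * ξ k * v i * w j := by
  simp only [dmet]
  rw [Finset.sum_comm' (t' := Finset.univ) (s' := fun _ => Finset.univ) (by simp)]
  rw [Finset.sum_comm]
  rw [Finset.sum_comm (s := Finset.univ (α := Fin n)) (t := Finset.univ (α := Fin n))
    (f := fun k i => ∑ j, fderiv ℝ (fun y => g y i j) x (stdb n k) * ξ k * v i * w j)]
  refine Finset.sum_congr rfl fun i _ => ?_
  rw [Finset.sum_comm]
  refine Finset.sum_congr rfl fun j _ => ?_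
  rw [fderiv_eq_sum _ x ξ, Finset.sum_mul, Finset.sum_mul]
  exact Finset.sum_congr rfl fun k _ => by ring

/-- The Koszul formula for constant vector fields. -/
theorem Met.RegularAt.minner_connForm {g : Met n} {x : Pt n} (hg : g.RegularAt x)
    (v w z : Pt n) :
    minner g x (connForm g x v w) z =
      (1 / 2) * (dmet g x v w z + dmet g x w v z - dmet g x z v w) := by
  have h1 : minner g x (connForm g x v w) z = ∑ m, ∑ i, ∑ j,
      (∑ k, g x m k * christoffel g x k i j) * v i * w j * z m := by
    rw [minner_comm hg.symm, minner]
    refine Finset.sum_congr rfl fun m _ => ?_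
    simp only [connForm, Finset.mul_sum, Finset.sum_mul]
    rw [Finset.sum_comm]
    refine Finset.sum_congr rfl fun i _ => ?_
    rw [Finset.sum_comm]
    refine Finset.sum_congr rfl fun j _ => Finset.sum_congr rfl fun k _ => by ring
  have h2 : dmet g x v w z = ∑ m, ∑ i, ∑ j,
      fderiv ℝ (fun y => g y j m) x (stdb n i) * v i * w j * z m := by
    rw [dmet_eq_sum]
    calc _ = ∑ i, ∑ m, ∑ j, fderiv ℝ (fun y => g y j m) x (stdb n i) * v i * w j * z m :=
          Finset.sum_congr rfl fun i _ => Finset.sum_comm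
      _ = _ := Finset.sum_comm
  have h3 : dmet g x w v z = ∑ m, ∑ i, ∑ j,
      fderiv ℝ (fun y => g y i m) x (stdb n j) * v i * w j * z m := by
    rw [dmet_eq_sum]
    calc _ = ∑ j, ∑ m, ∑ i, fderiv ℝ (fun y => g y i m) x (stdb n j) * w j * v i * z m :=
          Finset.sum_congr rfl fun j _ => Finset.sum_comm
      _ = ∑ m, ∑ j, ∑ i, fderiv ℝ (fun y => g y i m) x (stdb n j) * w j * v i * z m :=
          Finset.sum_comm
      _ = _ := Finset.sum_congr rfl fun m _ => by
          rw [Finset.sum_comm]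
          exact Finset.sum_congr rfl fun i _ => Finset.sum_congr rfl fun j _ => by ring
  have h4 : dmet g x z v w = ∑ m, ∑ i, ∑ j,
      fderiv ℝ (fun y => g y i j) x (stdb n m) * v i * w j * z m := by
    rw [dmet_eq_sum]
    exact Finset.sum_congr rfl fun m _ => Finset.sum_congr rfl fun i _ =>
      Finset.sum_congr rfl fun j _ => by ring
  rw [h1, h2, h3, h4]
  simp only [← Finset.sum_add_distrib, ← Finset.sum_sub_distrib, Finset.mul_sum]
  refine Finset.sum_congr rfl fun m _ => Finset.sum_congr rfl fun i _ =>
    Finset.sum_congr rfl fun j _ => ?_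
  rw [hg.sum_mul_christoffel]
  ring

theorem dmet_comm {g : Met n} (hg : ∀ y i j, g y i j = g y j i) (x ξ v w : Pt n) :
    dmet g x ξ v w = dmet g x ξ w v := by
  rw [dmet, Finset.sum_comm]
  refine Finset.sum_congr rfl fun i _ => Finset.sum_congr rfl fun j _ => ?_
  have : (fun y => g y j i) = fun y => g y i j := funext fun y => hg y j i
  rw [this]; ring

theorem Met.RegularAt.connForm_comm {g : Met n} {x : Pt n} (hg : g.RegularAt x)
    (v w : Pt n) : connForm g x v w = connForm g x w v := by
  refine hg.ext fun z => ?_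
  rw [hg.minner_connForm, hg.minner_connForm, dmet_comm hg.symm x z v w]
  ring

theorem Met.RegularAt.dmet_eq {g : Met n} {x : Pt n} (hg : g.RegularAt x) (ξ v w : Pt n) :
    dmet g x ξ v w = minner g x (connForm g x ξ v) w + minner g x v (connForm g x ξ w) := by
  rw [minner_comm hg.symm x v, hg.minner_connForm, hg.minner_connForm,
    dmet_comm hg.symm x w ξ v, dmet_comm hg.symm x v ξ w, dmet_comm hg.symm x ξ w v,
    dmet_comm hg.symm x v w ξ]
  ring

theorem hasFDerivAt_minner {E : Type*} [NormedAddCommGroup E] [NormedSpace ℝ E]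
    {g : Met n} {F W Z : E → Pt n} {u : E}
    (hg : ∀ i j, DifferentiableAt ℝ (fun y => g y i j) (F u))
    (hF : DifferentiableAt ℝ F u) (hW : DifferentiableAt ℝ W u) (hZ : DifferentiableAt ℝ Z u) :
    DifferentiableAt ℝ (fun y => minner g (F y) (W y) (Z y)) u ∧
    ∀ v, fderiv ℝ (fun y => minner g (F y) (W y) (Z y)) u v =
      dmet g (F u) (fderiv ℝ F u v) (W u) (Z u) + minner g (F u) (fderiv ℝ W u v) (Z u)
        + minner g (F u) (W u) (fderiv ℝ Z u v) := by
  have hWi : ∀ i, HasFDerivAt (fun y => W y i)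
      ((ContinuousLinearMap.proj i).comp (fderiv ℝ W u)) u := fun i =>
    (hasFDerivAt_pi'.1 hW.hasFDerivAt) i
  have hZi : ∀ i, HasFDerivAt (fun y => Z y i)
      ((ContinuousLinearMap.proj i).comp (fderiv ℝ Z u)) u := fun i =>
    (hasFDerivAt_pi'.1 hZ.hasFDerivAt) i
  have hgi : ∀ i j, HasFDerivAt (fun y => g (F y) i j)
      ((fderiv ℝ (fun y => g y i j) (F u)).comp (fderiv ℝ F u)) u := fun i j =>
    HasFDerivAt.comp u (hg i j).hasFDerivAt hF.hasFDerivAt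
  have h := HasFDerivAt.fun_sum (u := Finset.univ) fun i _ =>
    HasFDerivAt.fun_sum (u := Finset.univ) fun j _ => ((hgi i j).mul (hWi i)).mul (hZi j)
  refine ⟨h.differentiableAt, fun v => ?_⟩
  have hfd := congrArg (fun L => L v) h.fderiv
  simp only [Pi.mul_apply] at hfd
  refine hfd.trans ?_
  simp only [dmet, minner, ← Finset.sum_add_distrib]
  simp only [sum_apply, add_apply,
    smul_apply, ContinuousLinearMap.comp_apply,
    ContinuousLinearMap.proj_apply, smul_eq_mul]
  exact Finset.sum_congr rfl fun i _ => Finset.sum_congr rfl fun j _ => by ring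

end MetricAlgebra

section Along
variable {n : ℕ} {E : Type*} [NormedAddCommGroup E] [NormedSpace ℝ E]

/-- The covariant derivative in the direction `v` of the vector field `W` along the map `F`. -/
def covMap (g : Met n) (F W : E → Pt n) (u v : E) : Pt n :=
  fderiv ℝ W u v + connForm g (F u) (fderiv ℝ F u v) (W u)

theorem covAlong_eq {g : Met (n + 1)} {F W : Pt n → Pt (n + 1)} {u : Pt n}
    (hW : DifferentiableAt ℝ W u) (v : Pt n) :
    covAlong g F W u v = covMap g F W u v := by
  ext k
  simp only [covAlong, covMap, connForm, Pi.add_apply]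
  congr 1
  exact congrArg (fun L => L v) ((hasFDerivAt_pi'.1 hW.hasFDerivAt) k).fderiv

/-- The connection is compatible with the metric. -/
theorem fderiv_minner {g : Met n} {F W Z : E → Pt n} {u : E} (hg : g.RegularAt (F u))
    (hF : DifferentiableAt ℝ F u) (hW : DifferentiableAt ℝ W u) (hZ : DifferentiableAt ℝ Z u)
    (v : E) :
    fderiv ℝ (fun y => minner g (F y) (W y) (Z y)) u v =
      minner g (F u) (covMap g F W u v) (Z u) + minner g (F u) (W u) (covMap g F Z u v) := by
  rw [(hasFDerivAt_minner hg.diff hF hW hZ).2, hg.dmet_eq, covMap, covMap, minner_add_left,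
    minner_add_right]
  ring

/-- The connection is torsion free. -/
theorem covMap_fderiv_comm {g : Met n} {F : E → Pt n} {u : E} (hg : g.RegularAt (F u))
    (hF : ContDiffAt ℝ 2 F u) (a b : E) :
    covMap g F (fun y => fderiv ℝ F y a) u b = covMap g F (fun y => fderiv ℝ F y b) u a := by
  have hd : DifferentiableAt ℝ (fderiv ℝ F) u :=
    (hF.fderiv_right (m := 1) (by norm_num)).differentiableAt (by simp)
  have h (a b : E) : fderiv ℝ (fun y => fderiv ℝ F y a) u b = fderiv ℝ (fderiv ℝ F) u b a := by
    rw [fderiv_clm_apply hd (differentiableAt_const a)]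
    simp
  have hs : fderiv ℝ (fderiv ℝ F) u b a = fderiv ℝ (fderiv ℝ F) u a b :=
    (hF.isSymmSndFDerivAt (by simp)) b a
  rw [covMap, covMap, h, h, hs, hg.connForm_comm]

theorem covMap_congr {g : Met n} {F W W' : E → Pt n} {u : E} (h : W =ᶠ[𝓝 u] W') (v : E) :
    covMap g F W u v = covMap g F W' u v := by
  rw [covMap, covMap, h.fderiv_eq, h.eq_of_nhds]

theorem connForm_add_left (g : Met n) (x v v' w : Pt n) :
    connForm g x (v + v') w = connForm g x v w + connForm g x v' w := by
  ext k
  simp only [connForm, Pi.add_apply, ← Finset.sum_add_distrib]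
  exact Finset.sum_congr rfl fun i _ => Finset.sum_congr rfl fun j _ => by ring

theorem connForm_smul_left (g : Met n) (x v w : Pt n) (c : ℝ) :
    connForm g x (c • v) w = c • connForm g x v w := by
  ext k
  simp only [connForm, Pi.smul_apply, smul_eq_mul, Finset.mul_sum]
  exact Finset.sum_congr rfl fun i _ => Finset.sum_congr rfl fun j _ => by ring

theorem connForm_smul_right (g : Met n) (x v w : Pt n) (c : ℝ) :
    connForm g x v (c • w) = c • connForm g x v w := by
  ext k
  simp only [connForm, Pi.smul_apply, smul_eq_mul, Finset.mul_sum]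
  exact Finset.sum_congr rfl fun i _ => Finset.sum_congr rfl fun j _ => by ring

theorem covMap_add_dir (g : Met n) (F W : E → Pt n) (u v v' : E) :
    covMap g F W u (v + v') = covMap g F W u v + covMap g F W u v' := by
  simp only [covMap, map_add, connForm_add_left]
  abel

theorem covMap_smul_dir (g : Met n) (F W : E → Pt n) (u v : E) (c : ℝ) :
    covMap g F W u (c • v) = c • covMap g F W u v := by
  simp only [covMap, map_smul, connForm_smul_left, smul_add]

theorem covMap_smul {g : Met n} {F W : E → Pt n} {c : E → ℝ} {u : E}
    (hc : DifferentiableAt ℝ c u) (hW : DifferentiableAt ℝ W u) (v : E) :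
    covMap g F (fun y => c y • W y) u v = fderiv ℝ c u v • W u + c u • covMap g F W u v := by
  rw [covMap, fderiv_fun_smul hc hW, covMap, connForm_smul_right]
  simp only [add_apply, smul_apply, ContinuousLinearMap.smulRight_apply, smul_add]
  abel

/-- Chain rule for covariant derivatives along maps. -/
theorem covMap_comp {E' : Type*} [NormedAddCommGroup E'] [NormedSpace ℝ E'] {g : Met n}
    {F W : E → Pt n} {η : E' → E} {u : E'} (hη : DifferentiableAt ℝ η u)
    (hF : DifferentiableAt ℝ F (η u)) (hW : DifferentiableAt ℝ W (η u)) (v : E') :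
    covMap g (fun y => F (η y)) (fun y => W (η y)) u v = covMap g F W (η u) (fderiv ℝ η u v) := by
  have hF' := fderiv_comp u hF hη
  have hW' := fderiv_comp u hW hη
  simp only [Function.comp_def] at hF' hW'
  rw [covMap, covMap, hF', hW']
  rfl

end Along

section Warp
variable {n : ℕ} {E : Type*} [NormedAddCommGroup E] [NormedSpace ℝ E]

/-- Deletion of the first coordinate, as a continuous linear map. -/
def tailL (n : ℕ) : Pt (n + 1) →L[ℝ] Pt n :=
  ContinuousLinearMap.pi fun i => ContinuousLinearMap.proj i.succ

theorem tailL_apply (v : Pt (n + 1)) : tailL n v = Fin.tail v := rfl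

theorem fderiv_tail {F : E → Pt (n + 1)} {u : E} (hF : DifferentiableAt ℝ F u) (v : E) :
    fderiv ℝ (fun y => Fin.tail (F y) : E → Pt n) u v = Fin.tail (fderiv ℝ F u v) := by
  have h : HasFDerivAt (fun y => Fin.tail (F y) : E → Pt n) ((tailL n).comp (fderiv ℝ F u)) u :=
    (tailL n).hasFDerivAt.comp u hF.hasFDerivAt
  rw [h.fderiv]
  rfl

theorem fderiv_coord {F : E → Pt n} {u : E} (hF : DifferentiableAt ℝ F u) (v : E) (i : Fin n) :
    fderiv ℝ (fun y => F y i) u v = fderiv ℝ F u v i := by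
  rw [((hasFDerivAt_pi'.1 hF.hasFDerivAt) i).fderiv]
  rfl

theorem minner_warpMet (f : ℝ → ℝ) (g₀ : Met n) (x v w : Pt (n + 1)) :
    minner (warpMet f g₀) x v w =
      v 0 * w 0 + f (x 0) ^ 2 * minner g₀ (Fin.tail x) (Fin.tail v) (Fin.tail w) := by
  simp only [minner, warpMet, Fin.sum_univ_succ, Fin.cases_zero, Fin.cases_succ, Finset.mul_sum,
    zero_mul, Finset.sum_const_zero, add_zero, zero_add, one_mul]
  congr 1
  exact Finset.sum_congr rfl fun i _ => Finset.sum_congr rfl fun j _ => by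
    simp only [Fin.tail]; ring

theorem warpMet_regularAt {f : ℝ → ℝ} {g₀ : Met n} {x : Pt (n + 1)}
    (hf : DifferentiableAt ℝ f (x 0)) (hf0 : f (x 0) ≠ 0) (hg : g₀.RegularAt (Fin.tail x)) :
    (warpMet f g₀).RegularAt x := by
  refine ⟨fun y i j => ?_, fun i j => ?_, fun v hv => ?_⟩
  · refine Fin.cases (Fin.cases rfl (fun j' => rfl) j) (fun i' => Fin.cases rfl (fun j' => ?_) j) i
    simp only [warpMet, Fin.cases_succ, hg.symm _ i' j']
  · refine Fin.cases (Fin.cases ?_ (fun j' => ?_) j) (fun i' => Fin.cases ?_ (fun j' => ?_) j) i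
    · exact differentiableAt_const _
    · exact differentiableAt_const _
    · exact differentiableAt_const _
    · have h1 : DifferentiableAt ℝ (fun y : Pt (n + 1) => f (y 0)) x :=
        DifferentiableAt.comp x (g := f) hf (differentiableAt_apply 0 x)
      have h2 : DifferentiableAt ℝ (fun y : Pt (n + 1) => g₀ (Fin.tail y) i' j') x :=
        DifferentiableAt.comp x (g := fun z => g₀ z i' j') (hg.diff i' j')
          (tailL n).differentiableAt
      exact (h1.pow 2).mul h2
  · rw [minner_warpMet]
    by_cases h : Fin.tail v = (0 : Pt n)
    · have h0 : v 0 ≠ 0 := by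
        intro h0
        refine hv (funext fun i => Fin.cases h0 (fun i' => congrFun h i') i)
      rw [h, minner_zero_left, mul_zero, add_zero]
      exact mul_self_pos.2 h0
    · have := mul_pos (pow_pos (abs_pos.2 hf0) 2) (hg.pos _ h)
      rw [sq_abs] at this
      nlinarith [mul_self_nonneg (v 0)]

theorem dmet_eq_fderiv {g : Met n} {x : Pt n}
    (hg : ∀ i j, DifferentiableAt ℝ (fun y => g y i j) x) (ξ v w : Pt n) :
    dmet g x ξ v w = fderiv ℝ (fun y => minner g y v w) x ξ := by
  rw [(hasFDerivAt_minner (F := fun y => y) (W := fun _ => v) (Z := fun _ => w) hg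
    differentiableAt_id (differentiableAt_const _) (differentiableAt_const _)).2]
  simp [minner_zero_left, minner_zero_right]

theorem dmet_warpMet {f : ℝ → ℝ} {g₀ : Met n} {x : Pt (n + 1)}
    (hf : DifferentiableAt ℝ f (x 0)) (hf0 : f (x 0) ≠ 0) (hg : g₀.RegularAt (Fin.tail x))
    (ξ v w : Pt (n + 1)) :
    dmet (warpMet f g₀) x ξ v w =
      2 * f (x 0) * deriv f (x 0) * ξ 0 * minner g₀ (Fin.tail x) (Fin.tail v) (Fin.tail w) +
      f (x 0) ^ 2 * dmet g₀ (Fin.tail x) (Fin.tail ξ) (Fin.tail v) (Fin.tail w) := by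
  rw [dmet_eq_fderiv (warpMet_regularAt hf hf0 hg).diff, dmet_eq_fderiv hg.diff]
  have h0 : HasFDerivAt (fun y : Pt (n + 1) => f (y 0))
      (deriv f (x 0) • (ContinuousLinearMap.proj 0 : Pt (n + 1) →L[ℝ] ℝ)) x :=
    HasDerivAt.comp_hasFDerivAt x hf.hasDerivAt (hasFDerivAt_apply 0 x)
  have hd := (hasFDerivAt_minner (F := fun y => y) (W := fun _ => Fin.tail v)
    (Z := fun _ => Fin.tail w) hg.diff
    differentiableAt_id (differentiableAt_const _) (differentiableAt_const _)).1
  have h1 : HasFDerivAt (fun y : Pt (n + 1) =>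
      minner g₀ (Fin.tail y) (Fin.tail v) (Fin.tail w))
      ((fderiv ℝ (fun y => minner g₀ y (Fin.tail v) (Fin.tail w)) (Fin.tail x)).comp (tailL n)) x :=
    HasFDerivAt.comp x (g := fun y => minner g₀ y (Fin.tail v) (Fin.tail w))
      (f := tailL n) hd.hasFDerivAt (tailL n).hasFDerivAt
  have h2 := ((h0.pow 2).mul h1).const_add (v 0 * w 0)
  have heq : (fun y => minner (warpMet f g₀) y v w) = fun y : Pt (n + 1) => v 0 * w 0 +
      f (y 0) ^ 2 * minner g₀ (Fin.tail y) (Fin.tail v) (Fin.tail w) :=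
    funext fun y => minner_warpMet f g₀ y v w
  rw [heq]
  refine (congrArg (fun L => L ξ) h2.fderiv).trans ?_
  simp only [add_apply, smul_apply, ContinuousLinearMap.comp_apply,
    ContinuousLinearMap.proj_apply, smul_eq_mul, tailL_apply, nsmul_eq_mul]
  push_cast
  ring

theorem tail_cons (a : ℝ) (v : Pt n) : (Fin.tail (Fin.cons a v : Pt (n + 1)) : Pt n) = v := rfl

theorem connForm_warpMet {f : ℝ → ℝ} {g₀ : Met n} {x : Pt (n + 1)}
    (hf : DifferentiableAt ℝ f (x 0)) (hf0 : f (x 0) ≠ 0) (hg : g₀.RegularAt (Fin.tail x))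
    (v w : Pt (n + 1)) :
    connForm (warpMet f g₀) x v w =
      Fin.cons (-(f (x 0) * deriv f (x 0) * minner g₀ (Fin.tail x) (Fin.tail v) (Fin.tail w)))
        (connForm g₀ (Fin.tail x) (Fin.tail v) (Fin.tail w) +
          (deriv f (x 0) / f (x 0)) • (v 0 • (Fin.tail w : Pt n) + w 0 • (Fin.tail v : Pt n))) := by
  have hw := warpMet_regularAt hf hf0 hg
  refine hw.ext fun z => ?_
  rw [hw.minner_connForm, dmet_warpMet hf hf0 hg, dmet_warpMet hf hf0 hg, dmet_warpMet hf hf0 hg,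
    minner_warpMet, tail_cons, Fin.cons_zero, minner_add_left, minner_smul_left, minner_add_left,
    minner_smul_left, minner_smul_left, hg.minner_connForm]
  field_simp
  ring

/-- The Levi-Civita connection of a warped product, along a map. -/
theorem covMap_warpMet {f : ℝ → ℝ} {g₀ : Met n} {F W : E → Pt (n + 1)} {u : E}
    (hf : DifferentiableAt ℝ f (F u 0)) (hf0 : f (F u 0) ≠ 0)
    (hg : g₀.RegularAt (Fin.tail (F u)))
    (hF : DifferentiableAt ℝ F u) (hW : DifferentiableAt ℝ W u) (v : E) :
    covMap (warpMet f g₀) F W u v 0 = fderiv ℝ (fun y => W y 0) u v -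
        f (F u 0) * deriv f (F u 0) * minner g₀ (Fin.tail (F u))
          (fderiv ℝ (fun y => Fin.tail (F y)) u v) (Fin.tail (W u)) ∧
    Fin.tail (covMap (warpMet f g₀) F W u v) =
      covMap g₀ (fun y => Fin.tail (F y)) (fun y => Fin.tail (W y)) u v +
        (deriv f (F u 0) / f (F u 0)) •
          (fderiv ℝ (fun y => F y 0) u v • (Fin.tail (W u) : Pt n) +
            W u 0 • (fderiv ℝ (fun y => Fin.tail (F y)) u v : Pt n)) := by
  rw [covMap, connForm_warpMet hf hf0 hg, fderiv_tail hF, fderiv_coord hF, fderiv_coord hW]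
  refine ⟨by rw [Pi.add_apply, Fin.cons_zero]; ring, ?_⟩
  rw [covMap, fderiv_tail hW, fderiv_tail hF, add_assoc]
  rfl

end Warp

section Hypersurface
variable {n : ℕ}

theorem forall_of_stdb {P : Pt n → Prop} (h_zero : P 0) (h_add : ∀ v w, P v → P w → P (v + w))
    (h_smul : ∀ (c : ℝ) v, P v → P (c • v)) (h_stdb : ∀ i, P (stdb n i)) (v : Pt n) : P v := by
  have h : v = ∑ i, v i • stdb n i := by
    ext j
    simp [stdb, Pi.single_apply]
  rw [h]
  exact Finset.sum_induction _ P h_add h_zero fun i _ => h_smul _ _ (h_stdb i)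

theorem Hyp.IsRegular.minner_normal {S : Hyp n} {U : Set (Pt (n + 1))} {g : Met (n + 1)}
    (hS : S.IsRegular U g) {u : Pt n} (hu : u ∈ S.V) (v : Pt n) :
    minner g (S.F u) (S.N u) (fderiv ℝ S.F u v) = 0 := by
  refine forall_of_stdb (P := fun v => minner g (S.F u) (S.N u) (fderiv ℝ S.F u v) = 0) ?_ ?_ ?_
    (hS.2.2.2.2.2.2 u hu) v
  · rw [map_zero, minner_zero_right]
  · intro v w hv hw
    rw [map_add, minner_add_right, hv, hw, add_zero]
  · intro c v hv
    rw [map_smul, minner_smul_right, hv, mul_zero]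

theorem covMap_eq_smul_of_umbilical {g : Met (n + 1)} {F W : Pt n → Pt (n + 1)} {u : Pt n}
    {l : ℝ} (hW : DifferentiableAt ℝ W u)
    (h : ∀ a, covAlong g F W u (stdb n a) = l • fderiv ℝ F u (stdb n a)) (v : Pt n) :
    covMap g F W u v = l • fderiv ℝ F u v := by
  refine forall_of_stdb (P := fun v => covMap g F W u v = l • fderiv ℝ F u v) ?_ ?_ ?_
    (fun a => by rw [← covAlong_eq hW, h]) v
  · simpa using covMap_smul_dir g F W u 0 0
  · intro v w hv hw
    rw [covMap_add_dir, hv, hw, map_add, smul_add]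
  · intro c v hv
    rw [covMap_smul_dir, hv, map_smul, smul_comm]

theorem fderiv_injective_of_linearIndependent {F : Pt n → Pt (n + 1)} {u : Pt n}
    (h : LinearIndependent ℝ fun a : Fin n => fderiv ℝ F u (stdb n a)) {v : Pt n}
    (hv : fderiv ℝ F u v = 0) : v = 0 := by
  have h' : v = ∑ i, v i • stdb n i := by
    ext j
    simp [stdb, Pi.single_apply]
  rw [h', map_sum] at hv
  simp only [map_smul] at hv
  exact funext fun i => Fintype.linearIndependent_iff.1 h v hv i

/-- A totally umbilical hypersurface of a warped product carries a closed conformal field along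
its projection to the base. -/
theorem covMap_tail_normal {f : ℝ → ℝ} {g₀ : Met n} {F N : Pt n → Pt (n + 1)} {u v : Pt n}
    {l : ℝ} (hf : DifferentiableAt ℝ f (F u 0)) (hf0 : f (F u 0) ≠ 0)
    (hg : g₀.RegularAt (Fin.tail (F u)))
    (hF : DifferentiableAt ℝ F u) (hN : DifferentiableAt ℝ N u)
    (h : covMap (warpMet f g₀) F N u v = l • fderiv ℝ F u v) :
    covMap g₀ (fun y => Fin.tail (F y)) (fun y => (-f (F y 0)) • (Fin.tail (N y) : Pt n)) u v =
      (deriv f (F u 0) * N u 0 - l * f (F u 0)) •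
        fderiv ℝ (fun y => (Fin.tail (F y) : Pt n)) u v := by
  have hF0 : DifferentiableAt ℝ (fun y => F y 0) u :=
    (differentiableAt_pi.1 hF) 0
  have hτ : HasFDerivAt (fun y => -f (F y 0))
      (-(deriv f (F u 0) • fderiv ℝ (fun y => F y 0) u)) u :=
    (HasDerivAt.comp_hasFDerivAt u hf.hasDerivAt hF0.hasFDerivAt).neg
  have ht : DifferentiableAt ℝ (fun y => (Fin.tail (N y) : Pt n)) u :=
    ((tailL n).differentiableAt).comp u hN
  have h1 := (covMap_warpMet hf hf0 hg hF hN v).2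
  rw [h] at h1
  rw [covMap_smul hτ.differentiableAt ht, hτ.fderiv]
  have h2 : (Fin.tail (l • fderiv ℝ F u v) : Pt n) =
      l • fderiv ℝ (fun y => (Fin.tail (F y) : Pt n)) u v := by
    rw [fderiv_tail hF]; rfl
  rw [h2] at h1
  have h3 := eq_sub_of_add_eq h1.symm
  rw [h3]
  simp only [neg_apply, smul_apply, smul_eq_mul]
  ext i
  simp only [Pi.add_apply, Pi.smul_apply, Pi.sub_apply, smul_eq_mul]
  field_simp
  ring

/-- The closed conformal field on the base induced by a totally umbilical hypersurface which is
neither vertical nor horizontal. -/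
theorem exists_conformal_of_umbilical {I : Set ℝ} {f : ℝ → ℝ}
    (hf : ContDiff ℝ (⊤ : ℕ∞) f) (hfpos : ∀ t ∈ I, 0 < f t)
    {U₀ : Set (Pt n)} (hU₀ : IsOpen U₀) {g₀ : Met n} (hg₀ : IsMetricOn U₀ g₀)
    {S : Hyp n} (hS : S.IsRegular (warpDom I U₀) (warpMet f g₀))
    (hu : S.TotallyUmbilical (warpMet f g₀)) {u₀ : Pt n} (hu₀ : u₀ ∈ S.V)
    (hC : S.N u₀ 0 ≠ 0) {a : Pt n} (ha : fderiv ℝ (fun u => S.F u 0) u₀ a ≠ 0) :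
    ∃ (O : Set (Pt n)) (Z : Pt n → Pt n) (μ τ c : Pt n → ℝ),
      IsOpen O ∧ Fin.tail (S.F u₀) ∈ O ∧ O ⊆ U₀ ∧ ContDiffOn ℝ (⊤ : ℕ∞) Z O ∧
      ContDiffOn ℝ (⊤ : ℕ∞) τ O ∧
      (∀ x ∈ O, ∀ v, covMap g₀ (fun y => y) Z x v = μ x • v) ∧
      (∀ x ∈ O, c x ≠ 0 ∧ ∀ v, fderiv ℝ τ x v = c x * minner g₀ x (Z x) v) ∧
      ∃ v, fderiv ℝ τ (Fin.tail (S.F u₀)) v ≠ 0 := by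
  obtain ⟨l, hl⟩ := hu
  obtain ⟨hV, hF, hFU, hli, hN, -, -⟩ := id hS
  have hFd : ∀ u ∈ S.V, DifferentiableAt ℝ S.F u := fun u hu =>
    (hF.contDiffAt (hV.mem_nhds hu)).differentiableAt (by simp)
  have hNd : ∀ u ∈ S.V, DifferentiableAt ℝ S.N u := fun u hu =>
    (hN.contDiffAt (hV.mem_nhds hu)).differentiableAt (by simp)
  have hf0 : ∀ u ∈ S.V, f (S.F u 0) ≠ 0 := fun u hu => (hfpos _ (hFU u hu).1).ne'
  have hfd : Differentiable ℝ f := hf.differentiable (by simp)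
  set φ : Pt n → Pt n := fun u => Fin.tail (S.F u) with hφ
  have hφs : ContDiffOn ℝ (⊤ : ℕ∞) φ S.V := (tailL n).contDiff.comp_contDiffOn hF
  have hτs : ContDiffOn ℝ (⊤ : ℕ∞) (fun u => S.F u 0) S.V := contDiffOn_pi.1 hF 0
  have hCs : ContDiffOn ℝ (⊤ : ℕ∞) (fun u => S.N u 0) S.V := contDiffOn_pi.1 hN 0
  have horth : ∀ u ∈ S.V, ∀ v, S.N u 0 * fderiv ℝ (fun y => S.F y 0) u v =
      f (S.F u 0) * minner g₀ (φ u) ((-f (S.F u 0)) • (Fin.tail (S.N u) : Pt n))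
        (fderiv ℝ φ u v) := by
    intro u hu v
    have h := hS.minner_normal hu v
    rw [minner_warpMet, ← fderiv_coord (hFd u hu), ← fderiv_tail (hFd u hu)] at h
    rw [minner_smul_left]
    linear_combination h
  have hinj : ∀ v, fderiv ℝ φ u₀ v = 0 → v = 0 := by
    intro v hv
    refine fderiv_injective_of_linearIndependent (hli u₀ hu₀) ?_
    have h := horth u₀ hu₀ v
    rw [hv, minner_zero_right, mul_zero] at h
    have h0 := (mul_eq_zero.1 h).resolve_left hC
    rw [fderiv_coord (hFd _ hu₀)] at h0
    rw [hφ, fderiv_tail (hFd _ hu₀)] at hv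
    exact funext fun i => Fin.cases h0 (fun i => congrFun hv i) i
  obtain ⟨V', hV'o, hV'⟩ : ∃ V', IsOpen V' ∧ u₀ ∈ V' ∧ V' ⊆ S.V ∧ ∀ u ∈ V', S.N u 0 ≠ 0 :=
    ⟨S.V ∩ (fun u => S.N u 0) ⁻¹' {0}ᶜ,
      hCs.continuousOn.isOpen_inter_preimage hV isOpen_compl_singleton, ⟨hu₀, hC⟩,
      inter_subset_left, fun u hu => hu.2⟩
  let A : Pt n ≃L[ℝ] Pt n :=
    (LinearEquiv.ofInjectiveEndo (fderiv ℝ φ u₀ : Pt n →ₗ[ℝ] Pt n)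
      ((injective_iff_map_eq_zero _).2 hinj)).toContinuousLinearEquiv
  have hA : (A : Pt n →L[ℝ] Pt n) = fderiv ℝ φ u₀ := by
    ext1 v
    rfl
  have hφd : ∀ u ∈ S.V, DifferentiableAt ℝ φ u := fun u hu =>
    (hφs.contDiffAt (hV.mem_nhds hu)).differentiableAt (by simp)
  obtain ⟨e, he₀, heV, heφ, hes⟩ := exists_smooth_local_inverse hV'o
    (hφs.mono hV'.2.1) hV'.1 A (hA ▸ (hφd u₀ hu₀).hasFDerivAt)
  have hκ : ∀ x ∈ e.target, e.symm x ∈ S.V ∧ S.N (e.symm x) 0 ≠ 0 ∧ φ (e.symm x) = x ∧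
      DifferentiableAt ℝ e.symm x ∧ ∀ v, fderiv ℝ φ (e.symm x) (fderiv ℝ e.symm x v) = v := by
    intro x hx
    have h1 := heV (e.map_target hx)
    have hd : DifferentiableAt ℝ e.symm x :=
      (hes.contDiffAt (e.open_target.mem_nhds hx)).differentiableAt (by simp)
    refine ⟨hV'.2.1 h1, hV'.2.2 _ h1, by rw [← heφ]; exact e.right_inv hx, hd, fun v => ?_⟩
    have heq : (fun y => φ (e.symm y)) =ᶠ[𝓝 x] fun y => y := by
      filter_upwards [e.open_target.mem_nhds hx] with y hy
      rw [← heφ]; exact e.right_inv hy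
    have h2 := heq.fderiv_eq (𝕜 := ℝ)
    have h3 := fderiv_comp x (hφd _ (hV'.2.1 h1)) hd
    simp only [Function.comp_def] at h3
    rw [h3] at h2
    simpa using congrArg (fun L : Pt n →L[ℝ] Pt n => L v) h2
  have hmap : MapsTo e.symm e.target S.V := fun x hx => (hκ x hx).1
  have hp : φ u₀ ∈ e.target := by rw [← heφ]; exact e.map_source he₀
  have hτd : ∀ x ∈ e.target, ∀ v, fderiv ℝ (fun y => S.F (e.symm y) 0) x v =
      fderiv ℝ (fun u => S.F u 0) (e.symm x) (fderiv ℝ e.symm x v) := by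
    intro x hx v
    have := fderiv_comp (g := fun u => S.F u 0) x
      (differentiableAt_pi.1 (hFd _ (hκ x hx).1) 0) (hκ x hx).2.2.2.1
    exact congrArg (fun L => L v) this
  refine ⟨e.target, fun x => (-f (S.F (e.symm x) 0)) • (Fin.tail (S.N (e.symm x)) : Pt n),
    fun x => deriv f (S.F (e.symm x) 0) * S.N (e.symm x) 0 - l (e.symm x) * f (S.F (e.symm x) 0),
    fun x => S.F (e.symm x) 0, fun x => f (S.F (e.symm x) 0) / S.N (e.symm x) 0,
    e.open_target, hp, fun x hx => ?_, ?_, hτs.comp hes hmap, fun x hx v => ?_,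
    fun x hx => ⟨div_ne_zero (hf0 _ (hκ x hx).1) (hκ x hx).2.1, fun v => ?_⟩, ?_⟩
  · rw [← (hκ x hx).2.2.1]
    exact (hFU _ (hκ x hx).1).2
  · exact (((hf.comp_contDiffOn hτs).neg.smul ((tailL n).contDiff.comp_contDiffOn hN))).comp hes
      hmap
  · obtain ⟨hxV, -, hxφ, hxd, hxf⟩ := hκ x hx
    have hZd : DifferentiableAt ℝ (fun u => (-f (S.F u 0)) • (Fin.tail (S.N u) : Pt n))
        (e.symm x) := by
      have h1 : DifferentiableAt ℝ (fun u => -f (S.F u 0)) (e.symm x) :=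
        (DifferentiableAt.comp (g := f) (e.symm x) (hfd _)
          (differentiableAt_pi.1 (hFd _ hxV) 0)).neg
      have h2 : DifferentiableAt ℝ (fun u => (Fin.tail (S.N u) : Pt n)) (e.symm x) :=
        (tailL n).differentiableAt.comp _ (hNd _ hxV)
      exact h1.fun_smul h2
    have h1 := covMap_comp (g := g₀) (F := φ) (η := e.symm) hxd (hφd _ hxV) hZd v
    have h2 := covMap_tail_normal (hfd _) (hf0 _ hxV)
      (hg₀.regularAt hU₀ (hFU _ hxV).2) (hFd _ hxV) (hNd _ hxV)
      (covMap_eq_smul_of_umbilical (hNd _ hxV) (hl _ hxV) (fderiv ℝ e.symm x v))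
    have h3 : fderiv ℝ (fun y => φ (e.symm y)) x = fderiv ℝ (fun y : Pt n => y) x := by
      refine Filter.EventuallyEq.fderiv_eq ?_
      filter_upwards [e.open_target.mem_nhds hx] with y hy
      exact (hκ y hy).2.2.1
    rw [covMap, h3, hxφ] at h1
    rw [hxf] at h2
    exact h1.trans h2
  · obtain ⟨hxV, hxC, hxφ, hxd, hxf⟩ := hκ x hx
    have h := horth _ hxV (fderiv ℝ e.symm x v)
    rw [hxf, hxφ] at h
    rw [hτd x hx, div_mul_eq_mul_div, eq_div_iff hxC, mul_comm, h]
  · refine ⟨fderiv ℝ φ u₀ a, ?_⟩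
    have h0 : e.symm (φ u₀) = u₀ := by rw [← heφ]; exact e.left_inv he₀
    have h1 : fderiv ℝ e.symm (φ u₀) (fderiv ℝ φ u₀ a) = a := by
      have h := (hκ _ hp).2.2.2.2 (fderiv ℝ φ u₀ a)
      rw [h0, ← sub_eq_zero, ← map_sub] at h
      exact sub_eq_zero.1 (hinj _ h)
    rw [hτd _ hp, h1, h0]
    exact ha

end Hypersurface

section FlowBox
variable {n : ℕ}

/-- The projection of `Pt (n + 1)` annihilating the first coordinate. -/
def dropL (n : ℕ) : Pt (n + 1) →L[ℝ] Pt (n + 1) :=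
  ContinuousLinearMap.pi fun i =>
    Fin.cases 0
      (fun j => ContinuousLinearMap.proj (R := ℝ) (φ := fun _ : Fin (n + 1) => ℝ) j.succ) i

theorem dropL_apply_zero (v : Pt (n + 1)) : dropL n v 0 = 0 := rfl

theorem dropL_apply_succ (v : Pt (n + 1)) (j : Fin n) : dropL n v j.succ = v j.succ := rfl

theorem eq_smul_add_dropL (v : Pt (n + 1)) : v = v 0 • stdb (n + 1) 0 + dropL n v := by
  ext i
  refine Fin.cases ?_ (fun j => ?_) i
  · simp [stdb, dropL_apply_zero]
  · simp [stdb, dropL_apply_succ]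

theorem dropL_stdb_zero : dropL n (stdb (n + 1) 0) = 0 := by
  have h := eq_smul_add_dropL (stdb (n + 1) 0)
  simpa [stdb] using h

theorem exists_fderiv_stdb_ne_zero {f : Pt n → ℝ} {p v : Pt n} (h : fderiv ℝ f p v ≠ 0) :
    ∃ a, fderiv ℝ f p (stdb n a) ≠ 0 := by
  by_contra! h'
  refine h ?_
  have hv : v = ∑ i, v i • stdb n i := by
    ext j
    simp [stdb, Pi.single_apply]
  rw [hv, map_sum]
  exact Finset.sum_eq_zero fun i _ => by rw [map_smul, h', smul_zero]

/-- A smooth function with nonzero differential is the first coordinate of a smooth local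
coordinate system. -/
theorem exists_adapted_chart {O : Set (Pt (n + 1))} (hO : IsOpen O) {τ : Pt (n + 1) → ℝ}
    (hτ : ContDiffOn ℝ (⊤ : ℕ∞) τ O) {p : Pt (n + 1)} (hp : p ∈ O) {v : Pt (n + 1)}
    (hv : fderiv ℝ τ p v ≠ 0) :
    ∃ e : OpenPartialHomeomorph (Pt (n + 1)) (Pt (n + 1)), p ∈ e.source ∧ e.source ⊆ O ∧
      (∀ x, e x 0 = τ x) ∧ ContDiffOn ℝ (⊤ : ℕ∞) e e.source ∧
      ContDiffOn ℝ (⊤ : ℕ∞) e.symm e.target := by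
  obtain ⟨a, ha⟩ := exists_fderiv_stdb_ne_zero hv
  have hτd : DifferentiableAt ℝ τ p :=
    (hτ.contDiffAt (hO.mem_nhds hp)).differentiableAt (by simp)
  set K : Pt (n + 1) → Pt (n + 1) := fun x i => Fin.cases (τ x) (fun j => x (a.succAbove j)) i
    with hK
  let D : Pt (n + 1) →L[ℝ] Pt (n + 1) := ContinuousLinearMap.pi fun i =>
    Fin.cases (fderiv ℝ τ p) (fun j => ContinuousLinearMap.proj (R := ℝ)
      (φ := fun _ : Fin (n + 1) => ℝ) (a.succAbove j)) i
  have hKs : ContDiffOn ℝ (⊤ : ℕ∞) K O := contDiffOn_pi.2 fun i =>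
    Fin.cases hτ (fun j => (contDiff_apply ℝ ℝ (a.succAbove j)).contDiffOn) i
  have hD : HasFDerivAt K D p := hasFDerivAt_pi.2 fun i =>
    Fin.cases hτd.hasFDerivAt (fun j => hasFDerivAt_apply (a.succAbove j) p) i
  have hinj : ∀ w, D w = 0 → w = 0 := by
    intro w hw
    have h0 : fderiv ℝ τ p w = 0 := congrFun hw 0
    have h1 : ∀ j, w (a.succAbove j) = 0 := fun j => congrFun hw j.succ
    have h2 : w = w a • stdb (n + 1) a := by
      ext i
      rcases Fin.eq_self_or_eq_succAbove a i with rfl | ⟨j, rfl⟩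
      · simp [stdb]
      · simp [stdb, h1]
    rw [h2, map_smul, smul_eq_mul] at h0
    rw [h2, (mul_eq_zero.1 h0).resolve_right ha, zero_smul]
  let A : Pt (n + 1) ≃L[ℝ] Pt (n + 1) :=
    (LinearEquiv.ofInjectiveEndo (D : Pt (n + 1) →ₗ[ℝ] Pt (n + 1))
      ((injective_iff_map_eq_zero _).2 hinj)).toContinuousLinearEquiv
  have hA : (A : Pt (n + 1) →L[ℝ] Pt (n + 1)) = D := by
    ext1 v
    rfl
  obtain ⟨e, he₀, heO, heK, hes⟩ := exists_smooth_local_inverse hO hKs hp A (hA ▸ hD)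
  exact ⟨e, he₀, heO, fun x => by rw [heK]; rfl,
    (hKs.mono heO).congr fun x _ => heK x, hes⟩

/-- Flow box: coordinates straightening a vector field `X` transverse to a level set of `τ`, with
the level set as a coordinate slice. -/
theorem exists_flow_box {O : Set (Pt (n + 1))} (hO : IsOpen O) {X : Pt (n + 1) → Pt (n + 1)}
    (hX : ContDiffOn ℝ (⊤ : ℕ∞) X O) {τ : Pt (n + 1) → ℝ} (hτ : ContDiffOn ℝ (⊤ : ℕ∞) τ O)
    {p : Pt (n + 1)} (hp : p ∈ O) (hXτ : fderiv ℝ τ p (X p) ≠ 0) :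
    ∃ e : OpenPartialHomeomorph (Pt (n + 1)) (Pt (n + 1)), 0 ∈ e.source ∧ e 0 = p ∧
      e.target ⊆ O ∧ ContDiffOn ℝ (⊤ : ℕ∞) e e.source ∧ ContDiffOn ℝ (⊤ : ℕ∞) e.symm e.target ∧
      (∀ w ∈ e.source, fderiv ℝ e w (stdb (n + 1) 0) = X (e w)) ∧
      ∀ w ∈ e.source, w 0 = 0 → ∀ v : Pt (n + 1), v 0 = 0 →
        fderiv ℝ τ (e w) (fderiv ℝ e w v) = 0 := by
  obtain ⟨k, hpk, hkO, hkτ, hks, hks'⟩ := exists_adapted_chart hO hτ hp hXτ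
  obtain ⟨ε, hε, fl, hfl, hfl0, hfld⟩ := exists_smooth_flow hO hX hp
  set sl : Pt (n + 1) → Pt (n + 1) := fun w => k.symm (k p + dropL n w) with hsl
  set Θ : Pt (n + 1) → Pt (n + 1) := fun w => fl (w 0, sl w) with hΘ
  have htr : ContDiff ℝ (⊤ : ℕ∞) fun w : Pt (n + 1) => k p + dropL n w :=
    contDiff_const.add (dropL n).contDiff
  set D₁ : Set (Pt (n + 1)) := (fun w => k p + dropL n w) ⁻¹' k.target with hD₁
  have hD₁o : IsOpen D₁ := k.open_target.preimage htr.continuous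
  have hsls : ContDiffOn ℝ (⊤ : ℕ∞) sl D₁ := hks'.comp htr.contDiffOn fun w hw => hw
  have hps : ContDiffOn ℝ (⊤ : ℕ∞) (fun w : Pt (n + 1) => (w 0, sl w)) D₁ :=
    (contDiff_apply ℝ ℝ (0 : Fin (n + 1))).contDiffOn.prodMk hsls
  set D : Set (Pt (n + 1)) := D₁ ∩ (fun w => (w 0, sl w)) ⁻¹' ball ((0 : ℝ), p) ε with hD
  have hDo : IsOpen D := hps.continuousOn.isOpen_inter_preimage hD₁o isOpen_ball
  have hsl0 : sl 0 = p := by simp [hsl, k.left_inv hpk]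
  have h0D : (0 : Pt (n + 1)) ∈ D := by
    refine ⟨by simp [hD₁, k.map_source hpk], ?_⟩
    rw [mem_preimage, hsl0]
    exact mem_ball_self hε
  have hΘs : ContDiffOn ℝ (⊤ : ℕ∞) Θ D := hfl.comp (hps.mono inter_subset_left) fun w hw => hw.2
  have hΘd : ∀ w ∈ D, DifferentiableAt ℝ Θ w := fun w hw =>
    (hΘs.contDiffAt (hDo.mem_nhds hw)).differentiableAt (by simp)
  have hΘO : ∀ w ∈ D, Θ w ∈ O := fun w hw => (hfld _ hw.2).1
  have hline : ∀ (w v : Pt (n + 1)), HasDerivAt (fun s : ℝ => w + s • v) v 0 := fun w v => by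
    simpa using ((hasDerivAt_id (0 : ℝ)).smul_const v).const_add w
  have hΘ0 : ∀ w ∈ D, w 0 = 0 → Θ w = sl w := by
    intro w hw hw0
    have := hw.2
    rw [mem_preimage, mem_ball, Prod.dist_eq, max_lt_iff] at this
    rw [hΘ]
    simp only [hw0]
    exact hfl0 _ this.2
  have hdir : ∀ w ∈ D, fderiv ℝ Θ w (stdb (n + 1) 0) = X (Θ w) := by
    intro w hw
    have h1 : HasDerivAt (fun s : ℝ => Θ (w + s • stdb (n + 1) 0))
        (fderiv ℝ Θ w (stdb (n + 1) 0)) 0 := by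
      refine HasFDerivAt.comp_hasDerivAt_of_eq 0 (hΘd w hw).hasFDerivAt (hline w _) (by simp)
    have h2 : (fun s : ℝ => Θ (w + s • stdb (n + 1) 0)) = fun s => fl (s + w 0, sl w) := by
      funext s
      simp only [hΘ, hsl, map_add, map_smul, dropL_stdb_zero, smul_zero, add_zero]
      simp [stdb, add_comm]
    rw [h2] at h1
    have h3 := (hfld _ hw.2).2
    have h4 : HasDerivAt (fun s => fl (s + w 0, sl w)) (X (Θ w)) 0 := by
      refine HasDerivAt.comp_add_const (f := fun r => fl (r, sl w)) 0 (w 0) ?_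
      rw [zero_add]
      exact h3
    exact h1.unique h4
  have hk : ∀ w ∈ D, w 0 = 0 → ∀ v : Pt (n + 1), v 0 = 0 →
      fderiv ℝ k (Θ w) (fderiv ℝ Θ w v) = v := by
    intro w hw hw0 v hv0
    have hΘk : Θ w ∈ k.source := by rw [hΘ0 w hw hw0]; exact k.map_target hw.1
    have hkd : DifferentiableAt ℝ k (Θ w) :=
      (hks.contDiffAt (k.open_source.mem_nhds hΘk)).differentiableAt (by simp)
    have h1 : HasDerivAt (fun s : ℝ => k (Θ (w + s • v)))
        (fderiv ℝ k (Θ w) (fderiv ℝ Θ w v)) 0 := by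
      refine HasFDerivAt.comp_hasDerivAt_of_eq 0 (f := fun s : ℝ => Θ (w + s • v))
        hkd.hasFDerivAt ?_ (by simp)
      exact HasFDerivAt.comp_hasDerivAt_of_eq 0 (hΘd w hw).hasFDerivAt (hline w _) (by simp)
    have h2 : (fun s : ℝ => k (Θ (w + s • v))) =ᶠ[𝓝 0] fun s => (k p + w) + s • v := by
      have hc : ∀ᶠ s in 𝓝 (0 : ℝ), w + s • v ∈ D := by
        refine (hline w v).continuousAt.preimage_mem_nhds ?_
        simpa using hDo.mem_nhds hw
      filter_upwards [hc] with s hs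
      have hz : (w + s • v) 0 = 0 := by simp [hw0, hv0]
      rw [hΘ0 _ hs hz, hsl]
      have hd : dropL n (w + s • v) = w + s • v := by
        have := eq_smul_add_dropL (w + s • v)
        rw [hz, zero_smul, zero_add] at this
        exact this.symm
      have ht := hs.1
      simp only [hD₁, mem_preimage] at ht
      simp only
      rw [k.right_inv ht, hd, add_assoc]
    exact (h1.congr_of_eventuallyEq h2.symm).unique (hline (k p + w) v)
  have hτk : ∀ w ∈ D, w 0 = 0 → ∀ v : Pt (n + 1), v 0 = 0 →
      fderiv ℝ τ (Θ w) (fderiv ℝ Θ w v) = 0 := by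
    intro w hw hw0 v hv0
    have hΘk : Θ w ∈ k.source := by rw [hΘ0 w hw hw0]; exact k.map_target hw.1
    have hkd : DifferentiableAt ℝ k (Θ w) :=
      (hks.contDiffAt (k.open_source.mem_nhds hΘk)).differentiableAt (by simp)
    have h1 : τ = fun x => k x 0 := funext fun x => (hkτ x).symm
    have h2 := (hasFDerivAt_pi'.1 hkd.hasFDerivAt 0).fderiv
    rw [h1, h2]
    have h3 := congrFun (hk w hw hw0 v hv0) 0
    rw [hv0] at h3
    exact h3
  have hΘ00 : Θ 0 = p := by rw [hΘ0 0 h0D rfl, hsl0]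
  have hinj : ∀ v, fderiv ℝ Θ 0 v = 0 → v = 0 := by
    intro v hv
    have hdec := eq_smul_add_dropL v
    rw [hdec, map_add, map_smul, hdir 0 h0D, hΘ00] at hv
    have h1 := congrArg (fderiv ℝ τ p) hv
    have h2 := hτk 0 h0D rfl (dropL n v) (dropL_apply_zero v)
    rw [hΘ00] at h2
    rw [map_add, map_smul, h2, map_zero, add_zero, smul_eq_mul] at h1
    have h3 := (mul_eq_zero.1 h1).resolve_right hXτ
    rw [h3, zero_smul, zero_add] at hv
    have h4 := hk 0 h0D rfl (dropL n v) (dropL_apply_zero v)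
    rw [hv, map_zero] at h4
    rw [hdec, h3, ← h4, zero_smul, zero_add]
  let A : Pt (n + 1) ≃L[ℝ] Pt (n + 1) :=
    (LinearEquiv.ofInjectiveEndo (fderiv ℝ Θ 0 : Pt (n + 1) →ₗ[ℝ] Pt (n + 1))
      ((injective_iff_map_eq_zero _).2 hinj)).toContinuousLinearEquiv
  have hA : (A : Pt (n + 1) →L[ℝ] Pt (n + 1)) = fderiv ℝ Θ 0 := by
    ext1 v
    rfl
  obtain ⟨e, he₀, heD, heΘ, hes⟩ := exists_smooth_local_inverse hDo hΘs h0D A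
    (hA ▸ (hΘd 0 h0D).hasFDerivAt)
  have he : ⇑e = Θ := funext heΘ
  refine ⟨e, he₀, by rw [he, hΘ00], fun x hx => ?_, by rw [he]; exact hΘs.mono heD, hes, ?_, ?_⟩
  · rw [← e.right_inv hx, he]
    exact hΘO _ (heD (e.map_target hx))
  · rw [he]
    exact fun w hw => hdir w (heD hw)
  · rw [he]
    exact fun w hw => hτk w (heD hw)

end FlowBox

section WarpedOfConformal
variable {n : ℕ}

/-- Extension of a positive smooth function from a neighbourhood of `0` to the line. -/
theorem exists_contDiff_pos_extension {h : ℝ → ℝ} {ε : ℝ} (hε : 0 < ε)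
    (hs : ContDiffOn ℝ (⊤ : ℕ∞) h (ball 0 ε)) (hpos : ∀ r ∈ ball (0 : ℝ) ε, 0 < h r) :
    ∃ ψ : ℝ → ℝ, ContDiff ℝ (⊤ : ℕ∞) ψ ∧ (∀ r, 0 < ψ r) ∧
      ∀ r ∈ ball (0 : ℝ) (ε / 3), ψ r = h r := by
  let χ : ContDiffBump (0 : ℝ) := ⟨ε / 3, ε / 2, by positivity, by linarith⟩
  refine ⟨fun r => 1 + χ r * (h r - 1), contDiff_iff_contDiffAt.2 fun r => ?_, fun r => ?_,
    fun r hr => ?_⟩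
  · by_cases hr : r ∈ ball (0 : ℝ) ε
    · exact contDiffAt_const.add (χ.contDiffAt.mul
        ((hs.contDiffAt (isOpen_ball.mem_nhds hr)).sub contDiffAt_const))
    · have hr' : r ∈ (closedBall (0 : ℝ) (ε / 2))ᶜ := fun hc =>
        hr (closedBall_subset_ball (by linarith) hc)
      refine (contDiffAt_const (c := (1 : ℝ))).congr_of_eventuallyEq ?_
      filter_upwards [isClosed_closedBall.isOpen_compl.mem_nhds hr'] with y hy
      rw [χ.zero_of_le_dist (not_le.1 (fun hc => hy (mem_closedBall.2 hc))).le, zero_mul, add_zero]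
  · by_cases hr : r ∈ ball (0 : ℝ) ε
    · have h1 := χ.nonneg (x := r)
      have h2 := χ.le_one (x := r)
      have h3 := hpos r hr
      have : 1 + χ r * (h r - 1) = (1 - χ r) + χ r * h r := by ring
      simp only [this]
      rcases h1.lt_or_eq with h | h
      · have := mul_pos h h3
        linarith
      · rw [← h]; norm_num
    · have hr' : ε / 2 ≤ dist r 0 := by
        rw [mem_ball, not_lt] at hr
        linarith
      simp only [χ.zero_of_le_dist hr', zero_mul, add_zero]
      exact one_pos
  · simp only [χ.one_of_mem_closedBall (ball_subset_closedBall hr)]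
    ring

theorem IsMetricOn.contDiffOn_minner {U O : Set (Pt n)} {g : Met n} (hg : IsMetricOn U g)
    (hO : O ⊆ U) {Z : Pt n → Pt n} (hZ : ContDiffOn ℝ (⊤ : ℕ∞) Z O) :
    ContDiffOn ℝ (⊤ : ℕ∞) (fun x => minner g x (Z x) (Z x)) O :=
  ContDiffOn.sum fun i _ => ContDiffOn.sum fun j _ =>
    (((hg.1 i j).mono hO).mul (contDiffOn_pi.1 hZ i)).mul (contDiffOn_pi.1 hZ j)

/-- The derivatives of a metric in coordinates in which the first coordinate line integrates the
direction of a closed conformal field `Z = S ∂₀`. -/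
theorem fderiv_pullMet_of_conformal {g : Met (n + 1)} {Φ : Pt (n + 1) → Pt (n + 1)}
    {Z : Pt (n + 1) → Pt (n + 1)} {S : Pt (n + 1) → ℝ} {w : Pt (n + 1)} {μ : ℝ}
    (hg : g.RegularAt (Φ w)) (hΦ : ContDiffAt ℝ 2 Φ w) (hZ : DifferentiableAt ℝ Z (Φ w))
    (hS : DifferentiableAt ℝ S w) (hS0 : S w ≠ 0)
    (hμ : ∀ v, covMap g (fun y => y) Z (Φ w) v = μ • v)
    (hZS : ∀ᶠ y in 𝓝 w, Z (Φ y) = S y • fderiv ℝ Φ y (stdb (n + 1) 0))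
    (h1 : ∀ᶠ y in 𝓝 w, pullMet g Φ y 0 0 = 1) :
    (∀ i, fderiv ℝ S w (stdb (n + 1) i) = μ * pullMet g Φ w 0 i) ∧
    (∀ i, fderiv ℝ (fun y => pullMet g Φ y 0 i) w (stdb (n + 1) 0) = 0) ∧
    (∀ i j, pullMet g Φ w 0 i = 0 → pullMet g Φ w 0 j = 0 →
      S w * fderiv ℝ (fun y => pullMet g Φ y i j) w (stdb (n + 1) 0) =
        2 * μ * pullMet g Φ w i j) := by
  have hΦd : DifferentiableAt ℝ Φ w := hΦ.differentiableAt (by simp)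
  have hΦ2 : ∀ v, DifferentiableAt ℝ (fun y => fderiv ℝ Φ y v) w := fun v =>
    ((hΦ.fderiv_right (m := 1) (by norm_num)).differentiableAt (by simp)).clm_apply
      (differentiableAt_const v)
  have h00 := h1.self_of_nhds
  set d : Fin (n + 1) → Pt (n + 1) → Pt (n + 1) := fun i y => fderiv ℝ Φ y (stdb (n + 1) i) with hd
  have hcomm := minner_comm hg.symm (Φ w)
  have hcov : ∀ v, fderiv ℝ S w v • d 0 w + S w • covMap g Φ (d 0) w v =
      μ • fderiv ℝ Φ w v := by
    intro v
    rw [← covMap_smul hS (hΦ2 _), ← covMap_congr hZS,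
      covMap_comp (F := fun y => y) hΦd differentiableAt_id hZ, hμ]
  have horth : ∀ v, minner g (Φ w) (covMap g Φ (d 0) w v) (d 0 w) = 0 := by
    intro v
    have h := fderiv_minner hg hΦd (hΦ2 (stdb (n + 1) 0)) (hΦ2 (stdb (n + 1) 0)) v
    have hc : (fun y => minner g (Φ y) (d 0 y) (d 0 y)) =ᶠ[𝓝 w] fun _ => (1 : ℝ) := h1
    rw [hc.fderiv_eq, fderiv_const_apply, zero_apply] at h
    rw [hcomm (fderiv ℝ Φ w (stdb (n + 1) 0))] at h
    simp only [hd]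
    linarith
  have hdS : ∀ v, fderiv ℝ S w v = μ * minner g (Φ w) (d 0 w) (fderiv ℝ Φ w v) := by
    intro v
    have h := congrArg (fun z => minner g (Φ w) z (d 0 w)) (hcov v)
    simp only [minner_add_left, minner_smul_left, horth] at h
    have h00' : minner g (Φ w) (d 0 w) (d 0 w) = 1 := h00
    rw [h00', hcomm (fderiv ℝ Φ w v)] at h
    linarith
  have hcov0 : covMap g Φ (d 0) w (stdb (n + 1) 0) = 0 := by
    have h := hcov (stdb (n + 1) 0)
    have h00' : minner g (Φ w) (d 0 w) (fderiv ℝ Φ w (stdb (n + 1) 0)) = 1 := h00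
    rw [hdS, h00', mul_one] at h
    exact (smul_eq_zero.1 (add_eq_left.1 h)).resolve_left hS0
  have htor : ∀ i, covMap g Φ (d i) w (stdb (n + 1) 0) = covMap g Φ (d 0) w (stdb (n + 1) i) :=
    fun i => covMap_fderiv_comm hg hΦ _ _
  have hder : ∀ i j, fderiv ℝ (fun y => pullMet g Φ y i j) w (stdb (n + 1) 0) =
      minner g (Φ w) (covMap g Φ (d 0) w (stdb (n + 1) i)) (d j w) +
        minner g (Φ w) (d i w) (covMap g Φ (d 0) w (stdb (n + 1) j)) := by
    intro i j
    rw [← htor i, ← htor j]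
    exact fderiv_minner hg hΦd (hΦ2 (stdb (n + 1) i)) (hΦ2 (stdb (n + 1) j)) _
  refine ⟨fun i => hdS _, fun i => ?_, fun i j hi hj => ?_⟩
  · rw [hder, hcov0, minner_zero_left, hcomm, horth, add_zero]
  · have hc : ∀ k, pullMet g Φ w 0 k = 0 →
        S w • covMap g Φ (d 0) w (stdb (n + 1) k) = μ • d k w := by
      intro k hk
      have h := hcov (stdb (n + 1) k)
      rw [hdS] at h
      have hk' : minner g (Φ w) (d 0 w) (fderiv ℝ Φ w (stdb (n + 1) k)) = 0 := hk
      rw [hk', mul_zero, zero_smul, zero_add] at h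
      exact h
    rw [hder, mul_add, ← minner_smul_left, ← minner_smul_right, hc i hi, hc j hj,
      minner_smul_left, minner_smul_right]
    change μ * pullMet g Φ w i j + μ * pullMet g Φ w i j = _
    ring

theorem eq_of_fderiv_stdb_zero {h : Pt (n + 1) → ℝ} {ε : ℝ} (hε : 0 < ε)
    (hd : ∀ w ∈ ball (0 : Pt (n + 1)) ε, DifferentiableAt ℝ h w)
    (h0 : ∀ w ∈ ball (0 : Pt (n + 1)) ε, fderiv ℝ h w (stdb (n + 1) 0) = 0)
    {w : Pt (n + 1)} (hw : w ∈ ball (0 : Pt (n + 1)) ε) : h w = h (dropL n w) := by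
  have hmem : ∀ s ∈ Icc (0 : ℝ) 1, dropL n w + s • (w 0 • stdb (n + 1) 0) ∈
      ball (0 : Pt (n + 1)) ε := by
    intro s hs
    rw [mem_ball_zero_iff, pi_norm_lt_iff hε] at hw ⊢
    refine fun i => Fin.cases ?_ (fun j => ?_) i
    · have h1 : ‖w 0‖ < ε := hw 0
      simp only [Pi.add_apply, Pi.smul_apply, dropL_apply_zero, stdb, Pi.single_eq_same,
        smul_eq_mul, mul_one, zero_add, norm_mul]
      rw [Real.norm_of_nonneg hs.1]
      nlinarith [hs.2, norm_nonneg (w 0)]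
    · simpa [stdb, dropL_apply_succ] using hw j.succ
  have hder : ∀ s ∈ Icc (0 : ℝ) 1, HasDerivAt
      (fun s : ℝ => h (dropL n w + s • (w 0 • stdb (n + 1) 0))) 0 s := by
    intro s hs
    have h1 : HasDerivAt (fun s : ℝ => dropL n w + s • (w 0 • stdb (n + 1) 0))
        (w 0 • stdb (n + 1) 0) s := by
      simpa using ((hasDerivAt_id s).smul_const (w 0 • stdb (n + 1) 0)).const_add (dropL n w)
    have h2 := (hd _ (hmem s hs)).hasFDerivAt.comp_hasDerivAt s h1
    rw [map_smul, h0 _ (hmem s hs), smul_zero] at h2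
    exact h2
  have h3 := constant_of_has_deriv_right_zero
    (fun s hs => (hder s hs).continuousAt.continuousWithinAt)
    (fun s hs => (hder s (Ico_subset_Icc_self hs)).hasDerivWithinAt) 1 (by simp)
  rw [zero_smul, add_zero, one_smul, add_comm, ← eq_smul_add_dropL] at h3
  exact h3

theorem eq_of_fderiv_stdb_succ_zero {h : Pt (n + 1) → ℝ} {ε : ℝ} (hε : 0 < ε)
    (hd : ∀ w ∈ ball (0 : Pt (n + 1)) ε, DifferentiableAt ℝ h w)
    (h0 : ∀ w ∈ ball (0 : Pt (n + 1)) ε, ∀ i ≠ 0, fderiv ℝ h w (stdb (n + 1) i) = 0)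
    {w : Pt (n + 1)} (hw : w ∈ ball (0 : Pt (n + 1)) ε) : h w = h (w 0 • stdb (n + 1) 0) := by
  have hmem : ∀ s ∈ Icc (0 : ℝ) 1, w 0 • stdb (n + 1) 0 + s • dropL n w ∈
      ball (0 : Pt (n + 1)) ε := by
    intro s hs
    rw [mem_ball_zero_iff, pi_norm_lt_iff hε] at hw ⊢
    refine fun i => Fin.cases ?_ (fun j => ?_) i
    · simpa [stdb, dropL_apply_zero] using hw 0
    · have h1 : ‖w j.succ‖ < ε := hw j.succ
      simp only [Pi.add_apply, Pi.smul_apply, dropL_apply_succ, stdb, smul_eq_mul]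
      rw [Pi.single_eq_of_ne (Fin.succ_ne_zero j), mul_zero, zero_add, norm_mul,
        Real.norm_of_nonneg hs.1]
      nlinarith [hs.2, norm_nonneg (w j.succ)]
  have hdrop : ∀ y ∈ ball (0 : Pt (n + 1)) ε, fderiv ℝ h y (dropL n w) = 0 := by
    intro y hy
    rw [fderiv_eq_sum]
    refine Finset.sum_eq_zero fun i _ => ?_
    rcases eq_or_ne i 0 with rfl | hi
    · rw [dropL_apply_zero, zero_mul]
    · rw [h0 y hy i hi, mul_zero]
  have hder : ∀ s ∈ Icc (0 : ℝ) 1, HasDerivAt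
      (fun s : ℝ => h (w 0 • stdb (n + 1) 0 + s • dropL n w)) 0 s := by
    intro s hs
    have h1 : HasDerivAt (fun s : ℝ => w 0 • stdb (n + 1) 0 + s • dropL n w) (dropL n w) s := by
      simpa using ((hasDerivAt_id s).smul_const (dropL n w)).const_add (w 0 • stdb (n + 1) 0)
    have h2 := (hd _ (hmem s hs)).hasFDerivAt.comp_hasDerivAt s h1
    rw [hdrop _ (hmem s hs)] at h2
    exact h2
  have h3 := constant_of_has_deriv_right_zero
    (fun s hs => (hder s hs).continuousAt.continuousWithinAt)
    (fun s hs => (hder s (Ico_subset_Icc_self hs)).hasDerivWithinAt) 1 (by simp)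
  rw [zero_smul, add_zero, one_smul, ← eq_smul_add_dropL] at h3
  exact h3

theorem fderiv_div_sq_eq_zero_iff {E : Type*} [NormedAddCommGroup E] [NormedSpace ℝ E]
    {h S : E → ℝ} {w v : E} (hh : DifferentiableAt ℝ h w) (hS : DifferentiableAt ℝ S w)
    (hS0 : S w ≠ 0) :
    fderiv ℝ (fun y => h y / S y ^ 2) w v = 0 ↔
      S w * fderiv ℝ h w v = 2 * fderiv ℝ S w v * h w := by
  have h1 := (hasDerivAt_inv (pow_ne_zero 2 hS0)).comp_hasFDerivAt w (hS.hasFDerivAt.pow 2)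
  have h2 := hh.hasFDerivAt.mul h1
  have h3 : (fun y => h y / S y ^ 2) = h * ((fun y : ℝ => y⁻¹) ∘ fun x => S x ^ 2) :=
    funext fun y => div_eq_mul_inv _ _
  have h4 : fderiv ℝ (fun y => h y / S y ^ 2) w v =
      (S w * fderiv ℝ h w v - 2 * fderiv ℝ S w v * h w) / S w ^ 3 := by
    rw [h3, h2.fderiv]
    simp only [Function.comp_apply, add_apply, smul_apply, smul_eq_mul, nsmul_eq_mul]
    push_cast
    field_simp
    ring
  rw [h4, div_eq_zero_iff, or_iff_left (pow_ne_zero 3 hS0), sub_eq_zero]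

/-- A Riemannian manifold with a nowhere zero closed conformal field proportional to a gradient
is locally a warped product over an interval. -/
theorem locallyWarpedAt_of_conformal {U₀ O : Set (Pt (n + 1))} {g₀ : Met (n + 1)}
    (hU₀ : IsOpen U₀) (hg₀ : IsMetricOn U₀ g₀) (hO : IsOpen O) (hOU : O ⊆ U₀)
    {p : Pt (n + 1)} (hp : p ∈ O)
    {Z : Pt (n + 1) → Pt (n + 1)} {μ τ c : Pt (n + 1) → ℝ} (hZ : ContDiffOn ℝ (⊤ : ℕ∞) Z O)
    (hτ : ContDiffOn ℝ (⊤ : ℕ∞) τ O)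
    (hμ : ∀ x ∈ O, ∀ v, covMap g₀ (fun y => y) Z x v = μ x • v)
    (hc : ∀ x ∈ O, c x ≠ 0 ∧ ∀ v, fderiv ℝ τ x v = c x * minner g₀ x (Z x) v)
    {v₀ : Pt (n + 1)} (hv₀ : fderiv ℝ τ p v₀ ≠ 0) :
    LocallyWarpedAt U₀ g₀ p := by
  have hZp : Z p ≠ 0 := by
    intro h
    rw [(hc p hp).2, h, minner_zero_left, mul_zero] at hv₀
    exact hv₀ rfl
  set O' : Set (Pt (n + 1)) := O ∩ Z ⁻¹' {0}ᶜ with hO'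
  have hO'o : IsOpen O' := hZ.continuousOn.isOpen_inter_preimage hO isOpen_compl_singleton
  have hO'O : O' ⊆ O := inter_subset_left
  have hpos : ∀ x ∈ O', 0 < minner g₀ x (Z x) (Z x) := fun x hx => hg₀.2.2 x (hOU hx.1) _ hx.2
  set N : Pt (n + 1) → ℝ := fun x => √(minner g₀ x (Z x) (Z x)) with hN
  have hNs : ContDiffOn ℝ (⊤ : ℕ∞) N O' :=
    (hg₀.contDiffOn_minner (hO'O.trans hOU) (hZ.mono hO'O)).sqrt fun x hx => (hpos x hx).ne'
  have hNpos : ∀ x ∈ O', 0 < N x := fun x hx => Real.sqrt_pos.2 (hpos x hx)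
  have hNsq : ∀ x ∈ O', N x * N x = minner g₀ x (Z x) (Z x) := fun x hx =>
    Real.mul_self_sqrt (hpos x hx).le
  set X : Pt (n + 1) → Pt (n + 1) := fun x => (N x)⁻¹ • Z x with hX
  have hXs : ContDiffOn ℝ (⊤ : ℕ∞) X O' :=
    (hNs.inv fun x hx => (hNpos x hx).ne').smul (hZ.mono hO'O)
  have hpO' : p ∈ O' := ⟨hp, hZp⟩
  have hXτ : fderiv ℝ τ p (X p) ≠ 0 := by
    rw [(hc p hp).2, minner_smul_right]
    exact mul_ne_zero (hc p hp).1 (mul_ne_zero (inv_ne_zero (hNpos p hpO').ne') (hpos p hpO').ne')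
  obtain ⟨e, he0, hep, heO, hes, hes', heX, heτ⟩ :=
    exists_flow_box hO'o hXs (hτ.mono hO'O) hpO' hXτ
  obtain ⟨ε, hε, hεe⟩ := Metric.isOpen_iff.1 e.open_source 0 he0
  have hmap : ∀ w ∈ ball (0 : Pt (n + 1)) ε, e w ∈ O' := fun w hw => heO (e.map_source (hεe hw))
  have hreg : ∀ w ∈ ball (0 : Pt (n + 1)) ε, g₀.RegularAt (e w) := fun w hw =>
    hg₀.regularAt hU₀ (hOU (hO'O (hmap w hw)))
  have heat : ∀ w ∈ ball (0 : Pt (n + 1)) ε, ContDiffAt ℝ (⊤ : ℕ∞) e w := fun w hw =>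
    hes.contDiffAt (e.open_source.mem_nhds (hεe hw))
  set S : Pt (n + 1) → ℝ := fun w => N (e w) with hS
  have hSs : ContDiffOn ℝ (⊤ : ℕ∞) S (ball 0 ε) := hNs.comp (hes.mono hεe) hmap
  have hSpos : ∀ w ∈ ball (0 : Pt (n + 1)) ε, 0 < S w := fun w hw => hNpos _ (hmap w hw)
  have hSd : ∀ w ∈ ball (0 : Pt (n + 1)) ε, DifferentiableAt ℝ S w := fun w hw =>
    (hSs.contDiffAt (isOpen_ball.mem_nhds hw)).differentiableAt (by simp)
  have hZS : ∀ w ∈ ball (0 : Pt (n + 1)) ε,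
      Z (e w) = S w • fderiv ℝ e w (stdb (n + 1) 0) := by
    intro w hw
    rw [heX w (hεe hw), hX, smul_smul, mul_inv_cancel₀ (hSpos w hw).ne', one_smul]
  have h00 : ∀ w ∈ ball (0 : Pt (n + 1)) ε, pullMet g₀ e w 0 0 = 1 := by
    intro w hw
    rw [pullMet, heX w (hεe hw), hX, minner_smul_left, minner_smul_right, ← hNsq _ (hmap w hw)]
    have := (hNpos _ (hmap w hw)).ne'
    field_simp
  have hkey : ∀ w ∈ ball (0 : Pt (n + 1)) ε, _ := fun w hw =>
    fderiv_pullMet_of_conformal (hreg w hw) ((heat w hw).of_le (WithTop.coe_le_coe.2 le_top))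
      ((hZ.contDiffAt (hO.mem_nhds (hO'O (hmap w hw)))).differentiableAt (by simp)) (hSd w hw)
      (hSpos w hw).ne' (hμ _ (hO'O (hmap w hw)))
      (by filter_upwards [isOpen_ball.mem_nhds hw] with y hy using hZS y hy)
      (by filter_upwards [isOpen_ball.mem_nhds hw] with y hy using h00 y hy)
  have hpd : ∀ w ∈ ball (0 : Pt (n + 1)) ε, ∀ i j,
      DifferentiableAt ℝ (fun y => pullMet g₀ e y i j) w := by
    intro w hw i j
    have h2 : ∀ v, DifferentiableAt ℝ (fun y => fderiv ℝ e y v) w := fun v =>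
      (((heat w hw).fderiv_right (m := 1) (WithTop.coe_le_coe.2 le_top)).differentiableAt
        (by simp)).clm_apply (differentiableAt_const v)
    exact (hasFDerivAt_minner (hreg w hw).diff ((heat w hw).differentiableAt (by simp))
      (h2 _) (h2 _)).1
  have hdrop : ∀ w ∈ ball (0 : Pt (n + 1)) ε, dropL n w ∈ ball (0 : Pt (n + 1)) ε := by
    intro w hw
    rw [mem_ball_zero_iff, pi_norm_lt_iff hε] at hw ⊢
    refine fun i => Fin.cases ?_ (fun j => hw j.succ) i
    rw [dropL_apply_zero, norm_zero]
    exact hε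
  have h0i : ∀ w ∈ ball (0 : Pt (n + 1)) ε, ∀ i ≠ 0, pullMet g₀ e w 0 i = 0 := by
    intro w hw i hi
    rw [eq_of_fderiv_stdb_zero hε (fun y hy => hpd y hy 0 i) (fun y hy => (hkey y hy).2.1 i) hw]
    have hy := hdrop w hw
    have h1 := heτ _ (hεe hy) (dropL_apply_zero w) (stdb (n + 1) i)
      (by simp [stdb, hi.symm])
    have hcy := hc _ (hO'O (hmap _ hy))
    rw [hcy.2, hZS _ hy, minner_smul_left] at h1
    exact ((mul_eq_zero.1 ((mul_eq_zero.1 h1).resolve_left hcy.1)).resolve_left (hSpos _ hy).ne')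
  have hSw : ∀ w ∈ ball (0 : Pt (n + 1)) ε, S w = S (w 0 • stdb (n + 1) 0) := fun w hw =>
    eq_of_fderiv_stdb_succ_zero hε hSd
      (fun y hy i hi => by rw [(hkey y hy).1, h0i y hy i hi, mul_zero]) hw
  have hline : ∀ r ∈ ball (0 : ℝ) ε, r • stdb (n + 1) 0 ∈ ball (0 : Pt (n + 1)) ε := by
    intro r hr
    rw [mem_ball_zero_iff] at hr
    rw [mem_ball_zero_iff, pi_norm_lt_iff hε]
    refine fun i => Fin.cases ?_ (fun j => ?_) i
    · simpa [stdb] using hr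
    · simpa [stdb] using hε
  obtain ⟨ψ, hψs, hψpos, hψ⟩ := exists_contDiff_pos_extension hε
    (h := fun r => S (r • stdb (n + 1) 0))
    (hSs.comp (contDiff_id.smul contDiff_const).contDiffOn hline)
    (fun r hr => hSpos _ (hline r hr))
  have hsub : ball (0 : Pt (n + 1)) (ε / 3) ⊆ ball 0 ε := ball_subset_ball (by linarith)
  have him : e '' ball (0 : Pt (n + 1)) (ε / 3) ⊆ e.target := by
    rintro - ⟨w, hw, rfl⟩
    exact e.map_source (hεe (hsub hw))
  refine ⟨ball 0 (ε / 3), e, e.symm, isOpen_ball, hes.mono (hsub.trans hεe),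
    fun w hw => hOU (hO'O (hmap w (hsub hw))),
    e.isOpen_image_of_subset_source isOpen_ball (hsub.trans hεe),
    ⟨0, mem_ball_self (by positivity), hep⟩, hes'.mono him, fun w hw => e.left_inv (hεe (hsub hw)),
    ψ, hψs, hψpos, fun w hw => ⟨h00 w (hsub hw), fun i hi => ⟨h0i w (hsub hw) i hi, ?_⟩,
      fun i j hi hj => ?_⟩⟩
  · rw [pullMet, minner_comm (hreg w (hsub hw)).symm]
    exact h0i w (hsub hw) i hi
  · have hw' := hsub hw
    have heq : (fun y => pullMet g₀ e y i j / ψ (y 0) ^ 2) =ᶠ[𝓝 w]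
        fun y => pullMet g₀ e y i j / S y ^ 2 := by
      filter_upwards [isOpen_ball.mem_nhds hw] with y hy
      rw [hψ, ← hSw y (hsub hy)]
      rw [mem_ball_zero_iff, pi_norm_lt_iff (by positivity)] at hy
      exact mem_ball_zero_iff.2 (hy 0)
    obtain ⟨k1, -, k3⟩ := hkey w hw'
    have hk3 := k3 i j (h0i w hw' i hi) (h0i w hw' j hj)
    have hk1 := k1 0
    rw [h00 w hw', mul_one] at hk1
    rw [heq.fderiv_eq]
    rw [fderiv_div_sq_eq_zero_iff (hpd w hw' i j) (hSd w hw') (hSpos w hw').ne', hk1, hk3]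

end WarpedOfConformal

section UmbilicalOfWarped
variable {n : ℕ}

/-- The height function and the angle functions of a rotationally shaped umbilical
hypersurface. -/
theorem exists_umbilical_profile {I : Set ℝ} (hI : IsOpen I) {f ψ : ℝ → ℝ}
    (hf : ContDiff ℝ (⊤ : ℕ∞) f) (hψ : ContDiff ℝ (⊤ : ℕ∞) ψ) (hψpos : ∀ r, 0 < ψ r)
    {t : ℝ} (ht : t ∈ I) (r₀ : ℝ) :
    ∃ ε > 0, ∃ τ s C : ℝ → ℝ, ContDiffOn ℝ (⊤ : ℕ∞) τ (ball r₀ ε) ∧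
      ContDiffOn ℝ (⊤ : ℕ∞) s (ball r₀ ε) ∧ ContDiffOn ℝ (⊤ : ℕ∞) C (ball r₀ ε) ∧ τ r₀ = t ∧
      ∀ r ∈ ball r₀ ε, τ r ∈ I ∧ 0 < s r ∧ 0 < C r ∧ s r ^ 2 + C r ^ 2 = 1 ∧
        HasDerivAt τ (f (τ r) * s r / C r) r ∧
        HasDerivAt s (deriv ψ r / ψ r * s r) r ∧
        HasDerivAt C (-(deriv ψ r / ψ r * s r ^ 2 / C r)) r := by
  set s : ℝ → ℝ := fun r => 1 / (2 * ψ r₀) * ψ r with hs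
  set C : ℝ → ℝ := fun r => √(1 - s r ^ 2) with hC
  have hspos : ∀ r, 0 < s r := fun r =>
    mul_pos (one_div_pos.2 (mul_pos two_pos (hψpos r₀))) (hψpos r)
  have hss : ContDiff ℝ (⊤ : ℕ∞) s := contDiff_const.mul hψ
  have hsd : ∀ r, HasDerivAt s (deriv ψ r / ψ r * s r) r := by
    intro r
    refine ((hψ.differentiable (by simp) r).hasDerivAt.const_mul (1 / (2 * ψ r₀))).congr_deriv ?_
    have h1 := (hψpos r).ne'
    have h2 := (hψpos r₀).ne'
    simp only [hs]
    field_simp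
  set J : Set ℝ := {r | s r < 1} with hJ
  have hJo : IsOpen J := isOpen_lt hss.continuous continuous_const
  have hr₀ : r₀ ∈ J := by
    have := (hψpos r₀).ne'
    change 1 / (2 * ψ r₀) * ψ r₀ < 1
    field_simp
    norm_num
  have h1s : ∀ r ∈ J, 0 < 1 - s r ^ 2 := by
    intro r hr
    have h1 : s r < 1 := hr
    nlinarith [hspos r]
  have hCs : ContDiffOn ℝ (⊤ : ℕ∞) C J :=
    (contDiff_const.sub (hss.pow 2)).contDiffOn.sqrt fun r hr => (h1s r hr).ne'
  have hCpos : ∀ r ∈ J, 0 < C r := fun r hr => Real.sqrt_pos.2 (h1s r hr)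
  have hO : IsOpen (I ×ˢ J) := hI.prod hJo
  have hX : ContDiffOn ℝ (⊤ : ℕ∞)
      (fun y : ℝ × ℝ => (f y.1 * s y.2 / C y.2, (1 : ℝ))) (I ×ˢ J) := by
    refine ContDiffOn.prodMk (ContDiffOn.div ?_ (hCs.comp contDiff_snd.contDiffOn fun y hy => hy.2)
      fun y hy => (hCpos _ hy.2).ne') contDiffOn_const
    exact ((hf.comp contDiff_fst).mul (hss.comp contDiff_snd)).contDiffOn
  obtain ⟨ε, hε, fl, hfl, hfl0, hfld⟩ := exists_smooth_flow hO hX (p := (t, r₀)) ⟨ht, hr₀⟩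
  have hball : ∀ r ∈ ball r₀ ε, (r - r₀, (t, r₀)) ∈ ball ((0 : ℝ), (t, r₀)) ε := by
    intro r hr
    rw [mem_ball, Prod.dist_eq, dist_self, max_lt_iff]
    refine ⟨?_, hε⟩
    rw [Real.dist_eq, sub_zero, ← Real.dist_eq]
    exact hr
  set γ : ℝ → ℝ × ℝ := fun r => fl (r - r₀, (t, r₀)) with hγ
  have hγs : ContDiffOn ℝ (⊤ : ℕ∞) γ (ball r₀ ε) :=
    hfl.comp ((contDiff_id.sub contDiff_const).prodMk contDiff_const).contDiffOn hball
  have hγ0 : γ r₀ = (t, r₀) := by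
    rw [hγ]
    simp only [sub_self]
    exact hfl0 _ (mem_ball_self hε)
  have hγd : ∀ r ∈ ball r₀ ε,
      HasDerivAt γ (f (γ r).1 * s (γ r).2 / C (γ r).2, (1 : ℝ)) r := by
    intro r hr
    exact HasDerivAt.comp_sub_const (f := fun q => fl (q, (t, r₀))) r r₀ (hfld _ (hball r hr)).2
  have hγ2 : ∀ r ∈ ball r₀ ε, (γ r).2 = r := by
    intro r hr
    have hd : ∀ q ∈ ball r₀ ε, HasDerivAt (fun q => (γ q).2 - q) 0 q := fun q hq => by
      have h2 : HasDerivAt (fun q => (γ q).2) 1 q :=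
        (hasFDerivAt_snd (𝕜 := ℝ) (p := γ q)).comp_hasDerivAt q (hγd q hq)
      exact (h2.sub (hasDerivAt_id q)).congr_deriv (sub_self 1)
    have h := isOpen_ball.is_const_of_deriv_eq_zero (convex_ball r₀ ε).isPreconnected
      (fun q hq => (hd q hq).differentiableAt.differentiableWithinAt)
      (fun q hq => (hd q hq).deriv) hr (mem_ball_self hε)
    simp only [hγ0, sub_self] at h
    exact sub_eq_zero.1 h
  have hγJ : ∀ r ∈ ball r₀ ε, r ∈ J := fun r hr => by
    have := (hfld _ (hball r hr)).1.2
    rw [← hγ2 r hr]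
    exact this
  refine ⟨ε, hε, fun r => (γ r).1, s, C, contDiff_fst.comp_contDiffOn hγs, hss.contDiffOn,
    hCs.mono hγJ, by simp only [hγ0], fun r hr => ⟨(hfld _ (hball r hr)).1.1, hspos r,
    hCpos r (hγJ r hr), ?_, ?_, ?_, ?_⟩⟩
  · rw [hC, Real.sq_sqrt (h1s r (hγJ r hr)).le]
    ring
  · have h := hasFDerivAt_fst.comp_hasDerivAt r (hγd r hr)
    rw [hγ2 r hr] at h
    exact h
  · exact hsd r
  · have h := (((hsd r).pow 2).const_sub 1).sqrt (h1s r (hγJ r hr)).ne'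
    refine h.congr_deriv ?_
    have h1 := (hCpos r (hγJ r hr)).ne'
    change _ / (2 * C r) = _
    push_cast
    field_simp

/-- In warped coordinates, the coordinate field of the interval is closed and conformal up to
normalization. -/
theorem covMap_of_isWarped {g : Met (n + 1)} {Φ : Pt (n + 1) → Pt (n + 1)} {ψ : ℝ → ℝ}
    {W : Set (Pt (n + 1))} (hW : IsOpen W) {w : Pt (n + 1)} (hw : w ∈ W)
    (hg : g.RegularAt (Φ w)) (hΦ : ContDiffAt ℝ 2 Φ w)
    (hsurj : Function.Surjective (fderiv ℝ Φ w)) (hψ : Differentiable ℝ ψ) (hψ0 : ∀ r, 0 < ψ r)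
    (h : ∀ x ∈ W, pullMet g Φ x 0 0 = 1 ∧
      (∀ i : Fin (n + 1), i ≠ 0 → pullMet g Φ x 0 i = 0 ∧ pullMet g Φ x i 0 = 0) ∧
      (∀ i j : Fin (n + 1), i ≠ 0 → j ≠ 0 →
        fderiv ℝ (fun y => pullMet g Φ y i j / ψ (y 0) ^ 2) x (stdb (n + 1) 0) = 0))
    (a : Fin (n + 1)) :
    covMap g Φ (fun y => fderiv ℝ Φ y (stdb (n + 1) 0)) w (stdb (n + 1) a) =
      (deriv ψ (w 0) / ψ (w 0)) • (fderiv ℝ Φ w (stdb (n + 1) a) -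
        stdb (n + 1) a 0 • fderiv ℝ Φ w (stdb (n + 1) 0)) := by
  have hΦd : DifferentiableAt ℝ Φ w := hΦ.differentiableAt (by simp)
  have hΦ2 : ∀ v, DifferentiableAt ℝ (fun y => fderiv ℝ Φ y v) w := fun v =>
    ((hΦ.fderiv_right (m := 1) (by norm_num)).differentiableAt (by simp)).clm_apply
      (differentiableAt_const v)
  set B : Fin (n + 1) → Fin (n + 1) → Fin (n + 1) → ℝ := fun a b c =>
    minner g (Φ w) (covMap g Φ (fun y => fderiv ℝ Φ y (stdb (n + 1) b)) w (stdb (n + 1) a))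
      (fderiv ℝ Φ w (stdb (n + 1) c)) with hB
  have hBs : ∀ a b c, B a b c = B b a c := fun a b c => by
    simp only [hB]
    rw [covMap_fderiv_comm hg hΦ]
  have hdB : ∀ c a b, fderiv ℝ (fun y => pullMet g Φ y a b) w (stdb (n + 1) c) =
      B c a b + B c b a := fun c a b => by
    refine (fderiv_minner hg hΦd (hΦ2 _) (hΦ2 _) _).trans ?_
    rw [minner_comm hg.symm (Φ w) (fderiv ℝ Φ w (stdb (n + 1) a))]
  have hconst : ∀ {φ : Pt (n + 1) → ℝ} {k : ℝ}, (∀ y ∈ W, φ y = k) → fderiv ℝ φ w = 0 := by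
    intro φ k hφ
    have : φ =ᶠ[𝓝 w] fun _ => k := by
      filter_upwards [hW.mem_nhds hw] with y hy using hφ y hy
    rw [this.fderiv_eq, fderiv_const_apply]
  have h0 : ∀ c b, B c 0 b + B c b 0 = 0 := by
    intro c b
    rw [← hdB]
    rcases eq_or_ne b 0 with rfl | hb
    · rw [hconst fun y hy => (h y hy).1, zero_apply]
    · rw [hconst fun y hy => ((h y hy).2.1 b hb).1, zero_apply]
  have hij : ∀ i j, i ≠ 0 → j ≠ 0 →
      B 0 i j + B 0 j i = 2 * (deriv ψ (w 0) / ψ (w 0)) * pullMet g Φ w i j := by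
    intro i j hi hj
    have hd : DifferentiableAt ℝ (fun y => pullMet g Φ y i j) w :=
      (hasFDerivAt_minner hg.diff hΦd (hΦ2 _) (hΦ2 _)).1
    have hψw : HasFDerivAt (fun y : Pt (n + 1) => ψ (y 0))
        (deriv ψ (w 0) • (ContinuousLinearMap.proj 0 : Pt (n + 1) →L[ℝ] ℝ)) w :=
      HasDerivAt.comp_hasFDerivAt w (hψ (w 0)).hasDerivAt (hasFDerivAt_apply 0 w)
    have h1 := (fderiv_div_sq_eq_zero_iff hd hψw.differentiableAt (hψ0 _).ne').1
      ((h w hw).2.2 i j hi hj)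
    rw [hdB, hψw.fderiv] at h1
    simp only [smul_apply, ContinuousLinearMap.proj_apply, stdb, Pi.single_eq_same, smul_eq_mul,
      mul_one] at h1
    have := (hψ0 (w 0)).ne'
    field_simp
    linarith
  refine hg.ext fun z => ?_
  obtain ⟨v, rfl⟩ := hsurj z
  refine forall_of_stdb (P := fun v => minner g (Φ w) _ (fderiv ℝ Φ w v) =
    minner g (Φ w) _ (fderiv ℝ Φ w v)) ?_ ?_ ?_ (fun c => ?_) v
  · simp only [map_zero, minner_zero_right]
  · intro v v' hv hv'
    rw [map_add, minner_add_right, minner_add_right, hv, hv']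
  · intro k v hv
    rw [map_smul, minner_smul_right, minner_smul_right, hv]
  · rw [minner_smul_left, minner_sub_left, minner_smul_left]
    change B a 0 c = _ * (pullMet g Φ w a c - _ * pullMet g Φ w 0 c)
    have hw' := h w hw
    rcases eq_or_ne a 0 with rfl | ha
    · have h1 : stdb (n + 1) 0 0 = 1 := by simp [stdb]
      rw [h1, one_mul, sub_self, mul_zero]
      linarith [h0 0 c, h0 c 0, hBs 0 c 0]
    · have h1 : stdb (n + 1) a 0 = 0 := by simp [stdb, ha.symm]
      rw [h1, zero_mul, sub_zero]
      rcases eq_or_ne c 0 with rfl | hc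
      · rw [(hw'.2.1 a ha).2, mul_zero]
        linarith [h0 a 0]
      · linarith [hij a c ha hc, h0 a c, h0 c a, hBs 0 a c, hBs 0 c a, hBs a c 0]

end UmbilicalOfWarped

section Graph
variable {n : ℕ}

/-- The derivative of a left-invertible smooth map between spaces of equal dimension is
bijective. -/
theorem fderiv_bijective_of_leftInverse {Φ Ψ : Pt n → Pt n} {W : Set (Pt n)} (hW : IsOpen W)
    {w : Pt n} (hw : w ∈ W) (hΦ : DifferentiableAt ℝ Φ w) (hΨ : DifferentiableAt ℝ Ψ (Φ w))
    (h : ∀ y ∈ W, Ψ (Φ y) = y) : Function.Bijective (fderiv ℝ Φ w) := by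
  have hinj : Function.Injective (fderiv ℝ Φ w : Pt n →ₗ[ℝ] Pt n) := by
    have h1 := fderiv_comp w hΨ hΦ
    have h2 : Ψ ∘ Φ =ᶠ[𝓝 w] id := by
      filter_upwards [hW.mem_nhds hw] with y hy using h y hy
    rw [h2.fderiv_eq, fderiv_id] at h1
    refine Function.LeftInverse.injective (g := fderiv ℝ Ψ (Φ w)) fun v => ?_
    exact (congrArg (fun L : Pt n →L[ℝ] Pt n => L v) h1).symm
  exact ⟨hinj, LinearMap.surjective_of_injective hinj⟩

/-- The covariant derivative of the normal of the rotationally shaped hypersurface. -/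
theorem covMap_profile {f : ℝ → ℝ} {g₀ : Met (n + 1)} {Φ : Pt (n + 1) → Pt (n + 1)}
    {τ s C : ℝ → ℝ} {w : Pt (n + 1)} {q : ℝ} {F N : Pt (n + 1) → Pt (n + 2)}
    (hF : F = fun y => Fin.cons (τ (y 0)) (Φ y))
    (hN : N = fun y => Fin.cons (C (y 0))
      ((-(s (y 0) / f (τ (y 0)))) • fderiv ℝ Φ y (stdb (n + 1) 0)))
    (hf : DifferentiableAt ℝ f (τ (w 0))) (hf0 : f (τ (w 0)) ≠ 0) (hg : g₀.RegularAt (Φ w))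
    (hΦ : ContDiffAt ℝ 2 Φ w) (hFd : DifferentiableAt ℝ F w) (hNd : DifferentiableAt ℝ N w)
    (hC0 : C (w 0) ≠ 0)
    (hτ : HasDerivAt τ (f (τ (w 0)) * s (w 0) / C (w 0)) (w 0))
    (hs : HasDerivAt s (q * s (w 0)) (w 0))
    (hC : HasDerivAt C (-(q * s (w 0) ^ 2 / C (w 0))) (w 0)) {a : Fin (n + 1)}
    (h0a : pullMet g₀ Φ w a 0 = stdb (n + 1) a 0)
    (hcov : covMap g₀ Φ (fun y => fderiv ℝ Φ y (stdb (n + 1) 0)) w (stdb (n + 1) a) =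
      q • (fderiv ℝ Φ w (stdb (n + 1) a) - stdb (n + 1) a 0 • fderiv ℝ Φ w (stdb (n + 1) 0))) :
    covMap (warpMet f g₀) F N w (stdb (n + 1) a) =
      ((C (w 0) * deriv f (τ (w 0)) - q * s (w 0)) / f (τ (w 0))) •
        fderiv ℝ F w (stdb (n + 1) a) := by
  have hΦd : DifferentiableAt ℝ Φ w := hΦ.differentiableAt (by simp)
  have hΦ2 : DifferentiableAt ℝ (fun y => fderiv ℝ Φ y (stdb (n + 1) 0)) w :=
    ((hΦ.fderiv_right (m := 1) (by norm_num)).differentiableAt (by simp)).clm_apply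
      (differentiableAt_const _)
  have hcoord : HasFDerivAt (fun y : Pt (n + 1) => y 0)
      (ContinuousLinearMap.proj 0 : Pt (n + 1) →L[ℝ] ℝ) w := hasFDerivAt_apply 0 w
  have hτw : HasFDerivAt (fun y : Pt (n + 1) => τ (y 0)) _ w := hτ.comp_hasFDerivAt w hcoord
  have hCw : HasFDerivAt (fun y : Pt (n + 1) => C (y 0)) _ w := hC.comp_hasFDerivAt w hcoord
  have hκ : HasDerivAt (fun r => -(s r / f (τ r))) _ (w 0) :=
    (hs.div (hf.hasDerivAt.comp (w 0) hτ) hf0).neg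
  have hκw : HasFDerivAt (fun y : Pt (n + 1) => -(s (y 0) / f (τ (y 0)))) _ w :=
    HasDerivAt.comp_hasFDerivAt (h₂ := fun r => -(s r / f (τ r))) w hκ hcoord
  have hF0 : (fun y => F y 0) = fun y => τ (y 0) := by rw [hF]; rfl
  have hFt : (fun y => (Fin.tail (F y) : Pt (n + 1))) = Φ := by rw [hF]; rfl
  have hN0 : (fun y => N y 0) = fun y => C (y 0) := by rw [hN]; rfl
  have hNt : (fun y => (Fin.tail (N y) : Pt (n + 1))) =
      fun y => (-(s (y 0) / f (τ (y 0)))) • fderiv ℝ Φ y (stdb (n + 1) 0) := by rw [hN]; rfl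
  have eF0 : F w 0 = τ (w 0) := congrFun hF0 w
  have eFt : (Fin.tail (F w) : Pt (n + 1)) = Φ w := congrFun hFt w
  have eN0 : N w 0 = C (w 0) := congrFun hN0 w
  have eNt : (Fin.tail (N w) : Pt (n + 1)) =
    (-(s (w 0) / f (τ (w 0)))) • fderiv ℝ Φ w (stdb (n + 1) 0) := congrFun hNt w
  obtain ⟨h1, h2⟩ := covMap_warpMet (f := f) (g₀ := g₀) (F := F) (W := N) (u := w)
    (by rw [eF0]; exact hf) (by rw [eF0]; exact hf0) (by rw [eFt]; exact hg) hFd hNd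
    (stdb (n + 1) a)
  rw [eF0, eFt, eNt, hN0, hFt, hCw.fderiv, minner_smul_right] at h1
  rw [eF0, hFt, hNt, hF0, eNt, eN0, hτw.fderiv, covMap_smul hκw.differentiableAt hΦ2, hκw.fderiv,
    hcov] at h2
  have h0a' : minner g₀ (Φ w) (fderiv ℝ Φ w (stdb (n + 1) a)) (fderiv ℝ Φ w (stdb (n + 1) 0)) =
    stdb (n + 1) a 0 := h0a
  rw [h0a'] at h1
  have hd0 : fderiv ℝ F w (stdb (n + 1) a) 0 =
      f (τ (w 0)) * s (w 0) / C (w 0) * stdb (n + 1) a 0 := by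
    rw [← fderiv_coord hFd, hF0, hτw.fderiv]
    rfl
  have hdt : (Fin.tail (fderiv ℝ F w (stdb (n + 1) a)) : Pt (n + 1)) =
      fderiv ℝ Φ w (stdb (n + 1) a) := by
    rw [← fderiv_tail hFd, hFt]
  funext i
  refine Fin.cases ?_ (fun j => ?_) i
  · rw [h1, Pi.smul_apply, hd0]
    simp only [smul_apply, ContinuousLinearMap.proj_apply, smul_eq_mul]
    field_simp
    ring
  · have h3 := congrFun h2 j
    have h4 : fderiv ℝ F w (stdb (n + 1) a) j.succ = fderiv ℝ Φ w (stdb (n + 1) a) j :=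
      congrFun hdt j
    rw [Pi.smul_apply, h4]
    refine h3.trans ?_
    simp only [Pi.add_apply, Pi.smul_apply, Pi.sub_apply, smul_apply,
      ContinuousLinearMap.proj_apply, smul_eq_mul, Function.comp_apply]
    field_simp
    ring

/-- A warped product over a locally warped manifold contains a totally umbilical hypersurface
which is neither vertical nor horizontal. -/
theorem exists_umbilical_of_locallyWarpedAt {I : Set ℝ} (hI : IsOpen I) {f : ℝ → ℝ}
    (hf : ContDiff ℝ (⊤ : ℕ∞) f) (hfpos : ∀ t ∈ I, 0 < f t)
    {U₀ : Set (Pt (n + 1))} (hU₀ : IsOpen U₀) {g₀ : Met (n + 1)} (hg₀ : IsMetricOn U₀ g₀)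
    {t : ℝ} (ht : t ∈ I) {p : Pt (n + 1)} (h : LocallyWarpedAt U₀ g₀ p) :
    ∃ S : Hyp (n + 1), S.IsRegular (warpDom I U₀) (warpMet f g₀) ∧
      S.TotallyUmbilical (warpMet f g₀) ∧ ∃ u₀ ∈ S.V, S.F u₀ = Fin.cons t p ∧ S.N u₀ 0 ≠ 0 ∧
        fderiv ℝ S.F u₀ (stdb (n + 1) 0) 0 ≠ 0 := by
  obtain ⟨W, Φ, Ψ, hW, hΦ, hΦU, hΦW, ⟨w₀, hw₀, hp⟩, hΨ, hΨΦ, ψ, hψ, hψpos, hwarp⟩ := h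
  obtain ⟨ε, hε, τ, s, C, hτs, hss, hCs, hτ0, hprof⟩ :=
    exists_umbilical_profile hI hf hψ hψpos ht (w₀ 0)
  set V : Set (Pt (n + 1)) := W ∩ (fun w => w 0) ⁻¹' ball (w₀ 0) ε with hV
  have hc0 : ContDiff ℝ (⊤ : ℕ∞) fun w : Pt (n + 1) => w 0 := contDiff_apply ℝ ℝ 0
  have hVo : IsOpen V := hW.inter (isOpen_ball.preimage hc0.continuous)
  have hmap : MapsTo (fun w : Pt (n + 1) => w 0) V (ball (w₀ 0) ε) := fun w hw => hw.2
  have hΦat : ∀ w ∈ V, ContDiffAt ℝ (⊤ : ℕ∞) Φ w := fun w hw =>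
    hΦ.contDiffAt (hW.mem_nhds hw.1)
  have hΦbij : ∀ w ∈ V, Function.Bijective (fderiv ℝ Φ w) := fun w hw =>
    fderiv_bijective_of_leftInverse hW hw.1 ((hΦat w hw).differentiableAt (by simp))
      ((hΨ.contDiffAt (hΦW.mem_nhds (mem_image_of_mem Φ hw.1))).differentiableAt (by simp)) hΨΦ
  have hreg : ∀ w ∈ V, g₀.RegularAt (Φ w) := fun w hw => hg₀.regularAt hU₀ (hΦU hw.1)
  have h0a : ∀ w ∈ V, ∀ a, pullMet g₀ Φ w a 0 = stdb (n + 1) a 0 := by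
    intro w hw a
    rcases eq_or_ne a 0 with rfl | ha
    · rw [(hwarp w hw.1).1]
      simp [stdb]
    · rw [((hwarp w hw.1).2.1 a ha).2]
      simp [stdb, ha.symm]
  have hf0 : ∀ w ∈ V, 0 < f (τ (w 0)) := fun w hw => hfpos _ (hprof _ hw.2).1
  set F : Pt (n + 1) → Pt (n + 2) := fun y => Fin.cons (τ (y 0)) (Φ y) with hF
  set N : Pt (n + 1) → Pt (n + 2) := fun y => Fin.cons (C (y 0))
    ((-(s (y 0) / f (τ (y 0)))) • fderiv ℝ Φ y (stdb (n + 1) 0)) with hN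
  have hτV : ContDiffOn ℝ (⊤ : ℕ∞) (fun y : Pt (n + 1) => τ (y 0)) V :=
    hτs.comp hc0.contDiffOn hmap
  have hFs : ContDiffOn ℝ (⊤ : ℕ∞) F V := contDiffOn_pi.2 fun i => Fin.cases
    hτV (fun j => contDiffOn_pi.1 (hΦ.mono inter_subset_left) j) i
  have hd0s : ContDiffOn ℝ (⊤ : ℕ∞) (fun y => fderiv ℝ Φ y (stdb (n + 1) 0)) V :=
    ((hΦ.mono inter_subset_left).fderiv_of_isOpen hVo
      (WithTop.coe_le_coe.2 le_top)).clm_apply contDiffOn_const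
  have hκs : ContDiffOn ℝ (⊤ : ℕ∞) (fun y : Pt (n + 1) => -(s (y 0) / f (τ (y 0)))) V :=
    ((hss.comp hc0.contDiffOn hmap).div (hf.comp_contDiffOn hτV) fun w hw => (hf0 w hw).ne').neg
  have hNs : ContDiffOn ℝ (⊤ : ℕ∞) N V := contDiffOn_pi.2 fun i => Fin.cases
    (hCs.comp hc0.contDiffOn hmap) (fun j => contDiffOn_pi.1 (hκs.smul hd0s) j) i
  have hFd : ∀ w ∈ V, DifferentiableAt ℝ F w := fun w hw =>
    (hFs.contDiffAt (hVo.mem_nhds hw)).differentiableAt (by simp)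
  have hFt : ∀ w ∈ V, ∀ v, (Fin.tail (fderiv ℝ F w v) : Pt (n + 1)) = fderiv ℝ Φ w v := by
    intro w hw v
    rw [← fderiv_tail (hFd w hw)]
    rfl
  have hF0 : ∀ w ∈ V, ∀ v, fderiv ℝ F w v 0 = f (τ (w 0)) * s (w 0) / C (w 0) * v 0 := by
    intro w hw v
    rw [← fderiv_coord (hFd w hw)]
    have hcoord : HasFDerivAt (fun y : Pt (n + 1) => y 0)
        (ContinuousLinearMap.proj 0 : Pt (n + 1) →L[ℝ] ℝ) w := hasFDerivAt_apply 0 w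
    have h1 : HasFDerivAt (fun y : Pt (n + 1) => τ (y 0)) _ w :=
      HasDerivAt.comp_hasFDerivAt w (hprof _ hw.2).2.2.2.2.1 hcoord
    change fderiv ℝ (fun y : Pt (n + 1) => τ (y 0)) w v = _
    rw [h1.fderiv]
    rfl
  have hw₀V : w₀ ∈ V := ⟨hw₀, mem_ball_self hε⟩
  refine ⟨⟨V, F, N⟩, ⟨hVo, hFs, fun w hw => ⟨(hprof _ hw.2).1, hΦU hw.1⟩, fun w hw => ?_, hNs,
    fun w hw => ?_, fun w hw a => ?_⟩,
    ⟨fun w => (C (w 0) * deriv f (τ (w 0)) - deriv ψ (w 0) / ψ (w 0) * s (w 0)) / f (τ (w 0)),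
      fun w hw a => ?_⟩, w₀, hw₀V, ?_, (hprof _ hw₀V.2).2.2.1.ne', ?_⟩
  · have hinj : Function.Injective (fderiv ℝ F w) := fun v v' hv => by
      refine (hΦbij w hw).1 ?_
      rw [← hFt w hw, ← hFt w hw, hv]
    have hli : LinearIndependent ℝ (stdb (n + 1)) := by
      convert (Pi.basisFun ℝ (Fin (n + 1))).linearIndependent using 1
      ext i
      simp [stdb]
    exact hli.map' (fderiv ℝ F w : Pt (n + 1) →ₗ[ℝ] Pt (n + 2)) (LinearMap.ker_eq_bot.2 hinj)
  · have h00 : minner g₀ (Φ w) (fderiv ℝ Φ w (stdb (n + 1) 0))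
        (fderiv ℝ Φ w (stdb (n + 1) 0)) = 1 := (hwarp w hw.1).1
    change minner (warpMet f g₀) (F w) (N w) (N w) = 1
    rw [minner_warpMet]
    simp only [hF, hN, Fin.cons_zero, tail_cons, minner_smul_left, minner_smul_right]
    rw [h00]
    have h1 := (hf0 w hw).ne'
    have h2 := (hprof _ hw.2).2.2.2.1
    field_simp
    linear_combination h2
  · change minner (warpMet f g₀) (F w) (N w) (fderiv ℝ F w _) = 0
    have h1 : minner g₀ (Φ w) (fderiv ℝ Φ w (stdb (n + 1) 0))
        (fderiv ℝ Φ w (stdb (n + 1) a)) = stdb (n + 1) a 0 := by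
      rw [minner_comm (hreg w hw).symm]
      exact h0a w hw a
    rw [minner_warpMet, hF0 w hw, hFt w hw]
    simp only [hF, hN, Fin.cons_zero, tail_cons, minner_smul_left]
    rw [h1]
    have h2 := (hf0 w hw).ne'
    have h3 := (hprof _ hw.2).2.2.1.ne'
    field_simp
    ring
  · obtain ⟨-, -, hCpos, -, hdτ, hds, hdC⟩ := hprof _ hw.2
    have hNd : DifferentiableAt ℝ N w :=
      (hNs.contDiffAt (hVo.mem_nhds hw)).differentiableAt (by simp)
    have hΦ2 : ContDiffAt ℝ 2 Φ w := (hΦat w hw).of_le (WithTop.coe_le_coe.2 le_top)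
    rw [covAlong_eq hNd]
    exact covMap_profile hF hN (hf.differentiable (by simp) _) (hf0 w hw).ne' (hreg w hw) hΦ2
      (hFd w hw) hNd hCpos.ne' hdτ hds hdC (h0a w hw a)
      (covMap_of_isWarped hW hw.1 (hreg w hw) hΦ2 (hΦbij w hw).2 (hψ.differentiable (by simp))
        hψpos hwarp a)
  · change (Fin.cons (τ (w₀ 0)) (Φ w₀) : Pt (n + 2)) = _
    rw [hτ0, hp]
  · change fderiv ℝ F w₀ (stdb (n + 1) 0) 0 ≠ 0
    rw [hF0 w₀ hw₀V]
    have h1 : stdb (n + 1) 0 0 = 1 := by simp [stdb]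
    rw [h1, mul_one]
    exact div_ne_zero (mul_ne_zero (hf0 w₀ hw₀V).ne' (hprof _ hw₀V.2).2.1.ne')
      (hprof _ hw₀V.2).2.2.1.ne'

theorem minner_warpMet_stdb_zero (f : ℝ → ℝ) (g₀ : Met n) (x v : Pt (n + 1)) :
    minner (warpMet f g₀) x (stdb (n + 1) 0) v = v 0 := by
  have h : (Fin.tail (stdb (n + 1) 0) : Pt n) = 0 := by
    ext i
    simp [Fin.tail, stdb]
  rw [minner_warpMet, h, minner_zero_left, mul_zero, add_zero]
  simp [stdb]

end Graph

/-- Corollary 1.  A Riemannian warped product `I ×_f 𝕄ⁿ` admits a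
totally umbilical hypersurface which is neither vertical nor horizontal at a point
`(t,p)` if and only if `𝕄ⁿ` has, in a neighborhood of `p`, the structure of a warped
product of an interval of the Euclidean line with an `(n-1)`-dimensional manifold.
(Here `𝕄` has dimension `n+1`, the warped product has dimension `n+2`, the interval
coordinate being the `0`-th one, with vertical direction `∂_t`.) -/
theorem statement5 {n : ℕ} (I : Set ℝ) (hI : IsOpen I) (hIc : I.OrdConnected)
    (f : ℝ → ℝ) (hf : ContDiff ℝ (⊤ : ℕ∞) f) (hfpos : ∀ t ∈ I, 0 < f t)
    (U₀ : Set (Pt (n+1))) (hU₀ : IsOpen U₀)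
    (g₀ : Met (n+1)) (hg₀ : IsMetricOn U₀ g₀)
    (t : ℝ) (ht : t ∈ I) (p : Pt (n+1)) (hp : p ∈ U₀) :
    (∃ S : Hyp (n+1),
      S.IsRegular (warpDom I U₀) (warpMet f g₀) ∧
      S.TotallyUmbilical (warpMet f g₀) ∧
      ∃ u₀ ∈ S.V, S.F u₀ = Fin.cons t p ∧
        -- `Σ` is not vertical at `(t,p)` (`∂_t` is not tangent there):
        minner (warpMet f g₀) (S.F u₀) (stdb (n+2) 0) (S.N u₀) ≠ 0 ∧
        -- `Σ` is not horizontal at `(t,p)` (`∂_t` is not normal there):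
        (∃ a : Fin (n+1),
          minner (warpMet f g₀) (S.F u₀) (stdb (n+2) 0)
            (fderiv ℝ S.F u₀ (stdb (n+1) a)) ≠ 0))
    ↔ LocallyWarpedAt U₀ g₀ p := by
  constructor
  · rintro ⟨S, hS, hu, u₀, hu₀, hSp, hver, a, hhor⟩
    rw [minner_warpMet_stdb_zero] at hver hhor
    have hFd : DifferentiableAt ℝ S.F u₀ :=
      (hS.2.1.contDiffAt (hS.1.mem_nhds hu₀)).differentiableAt (by simp)
    rw [← fderiv_coord hFd] at hhor
    obtain ⟨O, Z, μ, τ, c, hO, hpO, hOU, hZ, hτ, hμ, hc, v, hv⟩ :=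
      exists_conformal_of_umbilical hf hfpos hU₀ hg₀ hS hu hu₀ hver hhor
    rw [hSp, tail_cons] at hpO hv
    exact locallyWarpedAt_of_conformal hU₀ hg₀ hO hOU hpO hZ hτ hμ hc hv
  · intro h
    obtain ⟨S, hS, hu, u₀, hu₀, hSp, hver, hhor⟩ :=
      exists_umbilical_of_locallyWarpedAt hI hf hfpos hU₀ hg₀ ht h
    refine ⟨S, hS, hu, u₀, hu₀, hSp, ?_, 0, ?_⟩
    · rwa [minner_warpMet_stdb_zero]
    · rwa [minner_warpMet_stdb_zero]
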